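/- arXiv:0905.1727 — 4 statements merged into one kernel-verified Lean document; each statement's English description precedes it below -/
import Mathlib

section
/- The modular lambda function satisfies 16·η(z/2)^8·η(2z)^16/η(z)^24 = 1 − η(z/2)^16·η(2z)^8/η(z)^24 for all z in the upper half-plane, where η is the Dedekind eta function. -/
open Complex

/-- The Dedekind eta function `η(z) = q^{1/24} ∏_{n ≥ 1} (1 - qⁿ)` with `q = e^{2πiz}`. -/
noncomputable def dedekindEta (z : ℂ) : ℂ :=
  Complex.exp (Real.pi * I * z / 12) *
    ∏' n : ℕ, (1 - Complex.exp (2 * Real.pi * I * (n + 1) * z))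

/-- The modular lambda function `λ(z) = 16 η(z/2)^8 η(2z)^16 / η(z)^24`. -/
noncomputable def modularLambda (z : ℂ) : ℂ :=
  16 * dedekindEta (z / 2) ^ 8 * dedekindEta (2 * z) ^ 16 / dedekindEta z ^ 24

open Filter Topology

namespace LamAux

/-- Euler product. -/
noncomputable def eul (q : ℂ) : ℂ := ∏' n : ℕ, (1 - q ^ (n + 1))

lemma eul_tendsto {q : ℂ} (hq : ‖q‖ < 1) :
    Tendsto (fun n => ∏ k ∈ Finset.range n, (1 - q ^ (k + 1))) atTop (𝓝 (eul q)) :=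
  (ModularForm.multipliable_one_sub_pow hq).hasProd.tendsto_prod_nat

lemma one_sub_pow_ne {q : ℂ} (hq : ‖q‖ < 1) (n : ℕ) : 1 - q ^ (n + 1) ≠ 0 := by
  intro h
  have h1 : q ^ (n + 1) = 1 := (sub_eq_zero.mp h).symm
  have h2 : ‖q‖ ^ (n + 1) = 1 := by rw [← norm_pow, h1, norm_one]
  have := pow_lt_one₀ (norm_nonneg q) hq (Nat.succ_ne_zero n)
  simp only [Nat.succ_eq_add_one] at this
  linarith

lemma eul_ne_zero {q : ℂ} (hq : ‖q‖ < 1) : eul q ≠ 0 := by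
  have : eul q = ∏' n : ℕ, (1 + (-q ^ (n + 1))) := by simp [eul, sub_eq_add_neg]
  rw [this]
  refine tprod_one_add_ne_zero_of_summable (f := fun n : ℕ => -q ^ (n + 1)) ?_ ?_
  · intro i
    simpa [sub_eq_add_neg] using one_sub_pow_ne hq i
  · simpa using (summable_nat_add_iff 1).mpr (summable_geometric_of_lt_one (norm_nonneg _) hq)

lemma norm_pow_lt {q : ℂ} (hq : ‖q‖ < 1) (n : ℕ) (hn : n ≠ 0) : ‖q ^ n‖ < 1 := by
  rw [norm_pow]; exact pow_lt_one₀ (norm_nonneg q) hq hn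

lemma tendsto_two_mul : Tendsto (fun n : ℕ => 2 * n) atTop atTop :=
  tendsto_atTop_mono (fun n => by simp only [id]; omega) tendsto_id

lemma eul_neg {q : ℂ} (hq : ‖q‖ < 1) :
    eul (-q) * eul q * eul (q ^ 4) = eul (q ^ 2) ^ 3 := by
  have hn : ‖-q‖ < 1 := by simpa using hq
  have h2 := norm_pow_lt hq 2 (by norm_num)
  have h4 := norm_pow_lt hq 4 (by norm_num)
  have L := (((eul_tendsto hn).comp tendsto_two_mul).mul
    ((eul_tendsto hq).comp tendsto_two_mul)).mul (eul_tendsto h4)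
  have R := ((eul_tendsto h2).comp tendsto_two_mul).mul ((eul_tendsto h2).pow 2)
  have : eul (q ^ 2) ^ 3 = eul (q ^ 2) * eul (q ^ 2) ^ 2 := by ring
  rw [this]
  refine tendsto_nhds_unique L (R.congr fun n => ?_)
  simp only [Function.comp]
  induction n with
  | zero => simp
  | succ n ih =>
    rw [show 2 * (n + 1) = 2 * n + 1 + 1 by ring]
    simp only [Finset.prod_range_succ]
    have e1 : (-q) ^ (2 * n + 1) = - q ^ (2 * n + 1) := Odd.neg_pow ⟨n, rfl⟩ q
    have e2 : (-q) ^ (2 * n + 1 + 1) = q ^ (2 * n + 1 + 1) := Even.neg_pow ⟨n + 1, by ring⟩ q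
    rw [e1, e2]
    simp only [← pow_mul] at ih ⊢
    linear_combination (1 - q ^ (4 * n + 2)) * (1 - q ^ (4 * n + 4)) * (1 - q ^ (2 * n + 2)) ^ 2
      * ih

/-- Shanks' partial products. -/
noncomputable def P (q : ℂ) (n : ℕ) : ℂ :=
  ∏ k ∈ Finset.range n, ((1 - q ^ (2 * k + 2)) / (1 - q ^ (2 * k + 1)))

lemma P_succ (q : ℂ) (n : ℕ) :
    P q (n + 1) = P q n * ((1 - q ^ (2 * n + 2)) / (1 - q ^ (2 * n + 1))) := by
  rw [P, P, Finset.prod_range_succ]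

lemma P_ne {q : ℂ} (hq : ‖q‖ < 1) (n : ℕ) : P q n ≠ 0 :=
  Finset.prod_ne_zero_iff.mpr fun k _ =>
    div_ne_zero (one_sub_pow_ne hq (2 * k + 1)) (one_sub_pow_ne hq (2 * k))

lemma P_tendsto {q : ℂ} (hq : ‖q‖ < 1) :
    Tendsto (P q) atTop (𝓝 (eul (q ^ 2) ^ 2 / eul q)) := by
  have h2 := norm_pow_lt hq 2 (by norm_num)
  refine (((eul_tendsto h2).pow 2).div ((eul_tendsto hq).comp tendsto_two_mul)
    (eul_ne_zero hq)).congr fun n => ?_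
  simp only [Function.comp, Pi.div_apply]
  induction n with
  | zero => simp [P]
  | succ n ih =>
    rw [P_succ, ← ih, show 2 * (n + 1) = 2 * n + 1 + 1 by ring]
    simp only [Finset.prod_range_succ]
    have a := one_sub_pow_ne hq (2 * n)
    have b := one_sub_pow_ne hq (2 * n + 1)
    have c : ∏ k ∈ Finset.range (2 * n), (1 - q ^ (k + 1)) ≠ 0 :=
      Finset.prod_ne_zero_iff.mpr fun k _ => one_sub_pow_ne hq k
    rw [show (q ^ 2) ^ (n + 1) = q ^ (2 * n + 1 + 1) by ring]
    rw [show 2 * n + 2 = 2 * n + 1 + 1 by ring]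
    field_simp

/-- Shanks' finite identity. -/
lemma shanks {q : ℂ} (hq : ‖q‖ < 1) (n : ℕ) :
    ∑ s ∈ Finset.range n, P q n / P q s * q ^ (s * (2 * n + 1)) =
      ∑ s ∈ Finset.range n, q ^ (s * (2 * s + 1)) * (1 + q ^ (2 * s + 1)) := by
  induction n with
  | zero => simp
  | succ n ih =>
    rw [Finset.sum_range_succ (fun s => q ^ (s * (2 * s + 1)) * (1 + q ^ (2 * s + 1))) n, ← ih]
    have key : ∀ m, ∑ s ∈ Finset.range m, (P q (n + 1) / P q s * q ^ (s * (2 * (n + 1) + 1))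
        - P q n / P q s * q ^ (s * (2 * n + 1))) =
        P q n / (1 - q ^ (2 * n + 1)) * ((1 - q ^ (2 * m)) / P q m * q ^ (m * (2 * n + 1))) := by
      intro m
      induction m with
      | zero => simp
      | succ m ihm =>
        rw [Finset.sum_range_succ, ihm, P_succ q m, P_succ q n]
        have a := one_sub_pow_ne hq (2 * n)
        have b := one_sub_pow_ne hq (2 * m)
        have c := one_sub_pow_ne hq (2 * m + 1)
        have d := P_ne hq m
        have e := P_ne hq n
        rw [show 2 * (m + 1) = 2 * m + 1 + 1 by ring]
        rw [show 2 * m + 2 = 2 * m + 1 + 1 by ring]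
        field_simp
        ring
    have k := key (n + 1)
    rw [Finset.sum_sub_distrib, Finset.sum_range_succ (fun s => P q n / P q s * _), P_succ q n] at k
    have a := one_sub_pow_ne hq (2 * n)
    have c := one_sub_pow_ne hq (2 * n + 1)
    have e := P_ne hq n
    have k2 : P q n / (1 - q ^ (2 * n + 1)) * ((1 - q ^ (2 * (n + 1))) /
        (P q n * ((1 - q ^ (2 * n + 2)) / (1 - q ^ (2 * n + 1)))) * q ^ ((n + 1) * (2 * n + 1)))
        = q ^ ((n + 1) * (2 * n + 1)) := by
      rw [show 2 * (n + 1) = 2 * n + 1 + 1 by ring]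
      rw [show 2 * n + 2 = 2 * n + 1 + 1 by ring]
      field_simp
    rw [k2, div_self e] at k
    rw [P_succ q n]
    linear_combination k

lemma psi_sum {q : ℂ} (hq : ‖q‖ < 1) :
    Tendsto (fun n => ∑ s ∈ Finset.range n, q ^ (s * (2 * s + 1)) * (1 + q ^ (2 * s + 1)))
      atTop (𝓝 (eul (q ^ 2) ^ 2 / eul q)) := by
  have hP := P_tendsto hq
  have hlim : eul (q ^ 2) ^ 2 / eul q ≠ 0 :=
    div_ne_zero (pow_ne_zero _ (eul_ne_zero (norm_pow_lt hq 2 (by norm_num)))) (eul_ne_zero hq)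
  obtain ⟨C1, h1⟩ := (Metric.isBounded_range_of_tendsto _ hP).exists_norm_le
  obtain ⟨C2, h2⟩ := (Metric.isBounded_range_of_tendsto _ (hP.inv₀ hlim)).exists_norm_le
  have b1 : ∀ n, ‖P q n‖ ≤ C1 := fun n => h1 _ ⟨n, rfl⟩
  have b2 : ∀ n, ‖(P q n)⁻¹‖ ≤ C2 := fun n => h2 _ ⟨n, rfl⟩
  have hC1 : 0 ≤ C1 := (norm_nonneg _).trans (b1 0)
  have hC2 : 0 ≤ C2 := (norm_nonneg _).trans (b2 0)
  have hrest : Tendsto (fun n => ∑ s ∈ Finset.range n,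
      P q (n + 1) / P q (s + 1) * q ^ ((s + 1) * (2 * (n + 1) + 1))) atTop (𝓝 0) := by
    have lim0 : Tendsto (fun n : ℕ => C1 * C2 * (n * ‖q‖ ^ n)) atTop (𝓝 0) := by
      simpa using (tendsto_self_mul_const_pow_of_lt_one (norm_nonneg q) hq).const_mul (C1 * C2)
    refine squeeze_zero_norm (fun n => ?_) lim0
    refine (norm_sum_le _ _).trans ?_
    have : ∀ s ∈ Finset.range n, ‖P q (n + 1) / P q (s + 1) * q ^ ((s + 1) * (2 * (n + 1) + 1))‖
        ≤ C1 * C2 * ‖q‖ ^ n := by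
      intro s _
      rw [norm_mul, div_eq_mul_inv, norm_mul, norm_pow]
      have : ‖q‖ ^ ((s + 1) * (2 * (n + 1) + 1)) ≤ ‖q‖ ^ n :=
        pow_le_pow_of_le_one (norm_nonneg _) hq.le (by nlinarith)
      gcongr
      · exact b1 _
      · exact b2 _
    refine (Finset.sum_le_sum this).trans (le_of_eq ?_)
    simp; ring
  have := hrest.add (hP.comp (tendsto_add_atTop_nat 1))
  rw [zero_add] at this
  refine (tendsto_add_atTop_iff_nat 1).mp (this.congr fun n => ?_)
  rw [← shanks hq, Finset.sum_range_succ']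
  simp [P]

/-- theta sums -/
noncomputable def F (q : ℂ) : ℂ := ∑' n : ℤ, q ^ (n ^ 2)
/-- theta sums -/
noncomputable def G (q : ℂ) : ℂ := ∑' n : ℤ, q ^ (n * (n + 1))

lemma sum_aux {q : ℂ} (h0 : q ≠ 0) (hq : ‖q‖ < 1) (f : ℤ → ℤ) (hf : ∀ n, |n| ≤ f n + 1) :
    Summable (fun n => ‖q ^ f n‖) := by
  have hpos : 0 < ‖q‖ := norm_pos_iff.mpr h0
  have hg : Summable (fun n : ℤ => ‖q‖ ^ (|n| - 1)) := by
    have hN : Summable (fun n : ℕ => ‖q‖ ^ ((n : ℤ) - 1)) := by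
      simp_rw [zpow_sub₀ hpos.ne', zpow_natCast]
      exact (summable_geometric_of_lt_one (norm_nonneg q) hq).div_const _
    refine Summable.of_nat_of_neg ?_ ?_ <;> simpa using hN
  refine Summable.of_nonneg_of_le (fun _ => norm_nonneg _) (fun n => ?_) hg
  rw [norm_zpow]
  exact zpow_le_zpow_right_of_le_one₀ hpos hq.le (by linarith [hf n])

lemma F_sum {q : ℂ} (h0 : q ≠ 0) (hq : ‖q‖ < 1) : Summable (fun n : ℤ => ‖q ^ (n ^ 2)‖) := by
  refine sum_aux h0 hq _ fun n => ?_
  rw [← sq_abs]; nlinarith [sq_nonneg (|n| - 1)]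

lemma G_sum {q : ℂ} (h0 : q ≠ 0) (hq : ‖q‖ < 1) : Summable (fun n : ℤ => ‖q ^ (n * (n + 1))‖) := by
  refine sum_aux h0 hq _ fun n => ?_
  rcases abs_cases n with ⟨h, _⟩ | ⟨h, _⟩ <;> rw [h] <;> nlinarith [sq_nonneg (n + 1)]

/-- Splitting of the square lattice by parity. -/
def latEquiv : (ℤ × ℤ) ⊕ (ℤ × ℤ) ≃ ℤ × ℤ where
  toFun := Sum.elim (fun p => (p.1 + p.2, p.1 - p.2)) (fun p => (p.1 + p.2 + 1, p.1 - p.2))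
  invFun p := if (p.1 + p.2) % 2 = 0 then Sum.inl ((p.1 + p.2) / 2, (p.1 - p.2) / 2)
    else Sum.inr ((p.1 + p.2 - 1) / 2, (p.1 - p.2 - 1) / 2)
  left_inv := by
    rintro (⟨u, v⟩ | ⟨u, v⟩)
    · dsimp only [Sum.elim_inl]
      split_ifs with h
      all_goals first | (exfalso; omega) | skip
      simp only [Sum.inl.injEq, Prod.mk.injEq]; omega
    · dsimp only [Sum.elim_inr]
      split_ifs with h
      all_goals first | (exfalso; omega) | skip
      simp only [Sum.inr.injEq, Prod.mk.injEq]; omega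
  right_inv := by
    rintro ⟨m, n⟩
    dsimp only
    split_ifs with h
    · simp only [Sum.elim_inl, Prod.mk.injEq]; omega
    · simp only [Sum.elim_inr, Prod.mk.injEq]; omega

lemma lat_split (f : ℤ × ℤ → ℂ) (hf : Summable f) :
    ∑' p, f p = ∑' p : ℤ × ℤ, f (p.1 + p.2, p.1 - p.2) +
      ∑' p : ℤ × ℤ, f (p.1 + p.2 + 1, p.1 - p.2) := by
  have h := latEquiv.summable_iff.mpr hf
  rw [← latEquiv.tsum_eq]
  exact Summable.tsum_sum (f := fun x => f (latEquiv x))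
    (h.comp_injective Sum.inl_injective) (h.comp_injective Sum.inr_injective)

lemma mul_tsum (f g : ℤ → ℂ) (hf : Summable (fun n => ‖f n‖)) (hg : Summable (fun n => ‖g n‖)) :
    (∑' n, f n) * (∑' n, g n) = ∑' p : ℤ × ℤ, f p.1 * g p.2 :=
  tsum_mul_tsum_of_summable_norm hf hg

lemma F_sq {q : ℂ} (h0 : q ≠ 0) (hq : ‖q‖ < 1) :
    F q ^ 2 = F (q ^ 2) ^ 2 + q * G (q ^ 2) ^ 2 := by
  have h02 : q ^ 2 ≠ 0 := pow_ne_zero _ h0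
  have h2 := norm_pow_lt hq 2 (by norm_num)
  have s := F_sum h0 hq
  have s1 := F_sum h02 h2
  have s2 := G_sum h02 h2
  rw [sq (F q), sq (F (q ^ 2)), sq (G (q ^ 2)), F, mul_tsum _ _ s s, lat_split _ (summable_mul_of_summable_norm s s), F, G,
    mul_tsum _ _ s1 s1, mul_tsum _ _ s2 s2, ← tsum_mul_left]
  congr 1
  · refine tsum_congr fun p => ?_
    rw [← zpow_natCast, ← zpow_mul, ← zpow_mul, ← zpow_add₀ h0, ← zpow_add₀ h0]
    congr 1; push_cast; ring
  · refine tsum_congr fun p => ?_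
    rw [← zpow_natCast, ← zpow_mul, ← zpow_mul, ← zpow_add₀ h0, ← zpow_add₀ h0, ← zpow_one_add₀ h0]
    congr 1; push_cast; ring

lemma shift_tsum (f : ℤ → ℂ) : ∑' n, f n = ∑' n, f (n + 1) :=
  ((Equiv.addRight (1 : ℤ)).tsum_eq f).symm

lemma shift_summable (f : ℤ → ℂ) (hf : Summable (fun n => ‖f n‖)) :
    Summable (fun n => ‖f (n + 1)‖) :=
  (Equiv.addRight (1 : ℤ)).summable_iff.mpr hf

lemma G_sq {q : ℂ} (h0 : q ≠ 0) (hq : ‖q‖ < 1) :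
    G q ^ 2 = 2 * (F (q ^ 2) * G (q ^ 2)) := by
  have h02 : q ^ 2 ≠ 0 := pow_ne_zero _ h0
  have h2 := norm_pow_lt hq 2 (by norm_num)
  have s := G_sum h0 hq
  have s1 := F_sum h02 h2
  have s2 := G_sum h02 h2
  have shift : F (q ^ 2) = ∑' n : ℤ, (q ^ 2) ^ ((n + 1) ^ 2) :=
    shift_tsum (fun n : ℤ => (q ^ 2) ^ (n ^ 2))
  have s1' : Summable (fun n : ℤ => ‖(q ^ 2) ^ ((n + 1) ^ 2)‖) :=
    shift_summable (fun n : ℤ => (q ^ 2) ^ (n ^ 2)) s1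
  have e : 2 * (F (q ^ 2) * G (q ^ 2)) = G (q ^ 2) * F (q ^ 2) + F (q ^ 2) * G (q ^ 2) := by ring
  have e1 : G (q ^ 2) * F (q ^ 2) =
      ∑' p : ℤ × ℤ, (q ^ 2) ^ (p.1 * (p.1 + 1)) * (q ^ 2) ^ (p.2 ^ 2) := by
    rw [G, F, mul_tsum _ _ s2 s1]
  have e2 : F (q ^ 2) * G (q ^ 2) =
      ∑' p : ℤ × ℤ, (q ^ 2) ^ ((p.1 + 1) ^ 2) * (q ^ 2) ^ (p.2 * (p.2 + 1)) := by
    rw [shift, G, mul_tsum _ _ s1' s2]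
  rw [e, e1, e2, sq (G q)]
  rw [G, mul_tsum _ _ s s, lat_split _ (summable_mul_of_summable_norm s s)]
  congr 1
  · refine tsum_congr fun p => ?_
    rw [← zpow_natCast, ← zpow_mul, ← zpow_mul, ← zpow_add₀ h0, ← zpow_add₀ h0]
    congr 1; push_cast; ring
  · refine tsum_congr fun p => ?_
    rw [← zpow_natCast, ← zpow_mul, ← zpow_mul, ← zpow_add₀ h0, ← zpow_add₀ h0]
    congr 1; push_cast; ring

lemma G_eq {q : ℂ} (h0 : q ≠ 0) (hq : ‖q‖ < 1) :
    G q = 2 * (eul (q ^ 4) ^ 2 / eul (q ^ 2)) := by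
  have h2 := norm_pow_lt hq 2 (by norm_num)
  have s := (G_sum h0 hq).of_norm
  have hp := psi_sum h2
  have sN : Summable (fun n : ℕ => q ^ (n * (n + 1))) := by
    have := s.comp_injective Nat.cast_injective
    refine this.congr fun n => ?_
    simp only [Function.comp]
    exact_mod_cast rfl
  have e1 : ∑' n : ℕ, q ^ (n * (n + 1)) = eul (q ^ 4) ^ 2 / eul (q ^ 2) := by
    have t := sN.hasSum.tendsto_sum_nat.comp tendsto_two_mul
    rw [← pow_mul] at hp
    refine tendsto_nhds_unique t (hp.congr fun n => ?_)
    simp only [Function.comp]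
    induction n with
    | zero => simp
    | succ n ih =>
      rw [Finset.sum_range_succ, ih, show 2 * (n + 1) = 2 * n + 1 + 1 by ring,
        Finset.sum_range_succ, Finset.sum_range_succ]
      ring
  have H := HasSum.of_nat_of_neg_add_one (f := fun n : ℤ => q ^ (n * (n + 1)))
    (m := ∑' n : ℕ, q ^ (n * (n + 1))) (m' := ∑' n : ℕ, q ^ (n * (n + 1)))
    (by convert sN.hasSum using 2 with n; exact_mod_cast rfl)
    (by
      convert sN.hasSum using 2 with n
      rw [← zpow_natCast]; congr 1; push_cast; ring)
  rw [G, H.tsum_eq, e1]; ring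

lemma F_eq {q : ℂ} (h0 : q ≠ 0) (hq : ‖q‖ < 1) :
    F q = eul (q ^ 2) ^ 5 / (eul q ^ 2 * eul (q ^ 4) ^ 2) := by
  obtain ⟨r, rfl⟩ := IsAlgClosed.exists_pow_nat_eq q (n := 2) (by norm_num)
  have hr0 : r ≠ 0 := by rintro rfl; simp at h0
  have hr : ‖r‖ < 1 := by
    rw [norm_pow] at hq
    exact (pow_lt_one_iff_of_nonneg (norm_nonneg r) (by norm_num)).mp hq
  have h := G_sq hr0 hr
  rw [G_eq hr0 hr, G_eq h0 hq] at h
  have n1 := eul_ne_zero hq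
  have n2 := eul_ne_zero (norm_pow_lt hq 2 (by norm_num))
  have n4 := eul_ne_zero (norm_pow_lt hq 4 (by norm_num))
  have e4 : r ^ 4 = (r ^ 2) ^ 2 := by ring
  rw [e4] at h
  generalize eul ((r ^ 2) ^ 2) = x2 at *
  generalize eul ((r ^ 2) ^ 4) = x4 at *
  field_simp at h ⊢
  linear_combination -h

lemma main {q : ℂ} (h0 : q ≠ 0) (hq : ‖q‖ < 1) :
    16 * q * eul q ^ 8 * eul (q ^ 4) ^ 16 =
      eul (q ^ 2) ^ 24 - eul q ^ 16 * eul (q ^ 4) ^ 8 := by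
  have hn0 : -q ≠ 0 := neg_ne_zero.mpr h0
  have hn : ‖-q‖ < 1 := by simpa using hq
  have a := F_sq h0 hq
  have b := F_sq hn0 hn
  have c := G_sq h0 hq
  have fq := F_eq h0 hq
  have fn := F_eq hn0 hn
  have en := eul_neg hq
  have g := G_eq h0 hq
  rw [neg_sq] at b
  rw [neg_sq, Even.neg_pow (by decide : Even 4)] at fn
  have d : F q ^ 4 - F (-q) ^ 4 = q * G q ^ 4 := by
    have : F q ^ 4 - F (-q) ^ 4 = (F q ^ 2) ^ 2 - (F (-q) ^ 2) ^ 2 := by ring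
    rw [this, a, b, show G q ^ 4 = (G q ^ 2) ^ 2 by ring, c]; ring
  have n1 := eul_ne_zero hq
  have nn := eul_ne_zero hn
  have n2 := eul_ne_zero (norm_pow_lt hq 2 (by norm_num))
  have n4 := eul_ne_zero (norm_pow_lt hq 4 (by norm_num))
  have en' : eul (-q) = eul (q ^ 2) ^ 3 / (eul q * eul (q ^ 4)) := by
    field_simp; linear_combination en
  have fn' : F (-q) = eul q ^ 2 / eul (q ^ 2) := by
    rw [fn, en']; field_simp
  rw [fq, fn', g] at d
  field_simp at d
  linear_combination -d

end LamAux

open LamAux in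
theorem lambda_eq_one_sub (z : ℂ) (hz : 0 < z.im) :
    modularLambda z =
      1 - dedekindEta (z / 2) ^ 16 * dedekindEta (2 * z) ^ 8 / dedekindEta z ^ 24 := by
  have key : ∀ w, dedekindEta w =
      Complex.exp (Real.pi * I * w / 12) * eul (Complex.exp (2 * Real.pi * I * w)) := by
    intro w
    rw [dedekindEta, eul]
    congr 1
    refine tprod_congr fun n => ?_
    rw [← Complex.exp_nat_mul]; push_cast; ring_nf
  set t := Complex.exp (Real.pi * I * z / 24) with ht
  have ht0 : t ≠ 0 := Complex.exp_ne_zero _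
  set q := Complex.exp (Real.pi * I * z) with hqd
  have hq0 : q ≠ 0 := Complex.exp_ne_zero _
  have htq : t ^ 24 = q := by
    rw [ht, hqd, ← Complex.exp_nat_mul]; push_cast; ring_nf
  have hq : ‖q‖ < 1 := by
    rw [hqd, Complex.norm_exp]
    simp
    positivity
  have k1 : dedekindEta (z / 2) = t * eul q := by
    rw [key, ht, hqd]; congr 2 <;> ring_nf
  have k2 : dedekindEta z = t ^ 2 * eul (q ^ 2) := by
    rw [key, ht, hqd, ← Complex.exp_nat_mul, ← Complex.exp_nat_mul]
    push_cast; congr 2 <;> ring_nf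
  have k4 : dedekindEta (2 * z) = t ^ 4 * eul (q ^ 4) := by
    rw [key, ht, hqd, ← Complex.exp_nat_mul, ← Complex.exp_nat_mul]
    push_cast; congr 2 <;> ring_nf
  have m := main hq0 hq
  have n2 := eul_ne_zero (norm_pow_lt hq 2 (by norm_num))
  rw [modularLambda, k1, k2, k4]
  generalize eul q = x1 at *
  generalize eul (q ^ 2) = x2 at *
  generalize eul (q ^ 4) = x4 at *
  rw [← htq] at m
  clear_value t
  field_simp
  linear_combination m
end

section
/- The derivative of the modular lambda function λ(z) = 16·η(z/2)^8·η(2z)^16/η(z)^24 is given by λ'(z) = 16πi·η(z/2)^16·η(2z)^16/η(z)^28 for all z in the upper half-plane. -/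
open Complex

open Filter Topology

noncomputable section LambdaAux

/-- The Euler product. -/
def PP (q : ℂ) : ℂ := ∏' n : ℕ, (1 - q ^ (n + 1))

def LL (q : ℂ) : ℂ := deriv PP q / PP q

def GG (q : ℂ) : ℂ := 1 + 24 * q * LL q

def ee (z : ℂ) : ℂ := GG (Complex.exp (2 * Real.pi * I * z))

lemma PP_ne {q : ℂ} (hq : ‖q‖ < 1) : PP q ≠ 0 := by
  unfold PP
  simp only [sub_eq_add_neg]
  refine tprod_one_add_ne_zero_of_summable (f := fun n ↦ -q ^ (n + 1)) ?_ ?_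
  · intro i h
    have h1 : q ^ (i + 1) = 1 := by linear_combination -h
    have h2 : ‖q‖ ^ (i + 1) = 1 := by rw [← norm_pow, h1, norm_one]
    have := pow_lt_one₀ (norm_nonneg q) hq (Nat.succ_ne_zero i)
    simp only [Nat.succ_eq_add_one] at this
    linarith
  · simpa using (summable_nat_add_iff 1).mpr (summable_geometric_of_lt_one (norm_nonneg _) hq)

lemma PP_diffOn : DifferentiableOn ℂ PP (Metric.ball 0 1) :=
  ModularForm.differentiableOn_tprod_one_sub_pow

lemma PP_diffAt {q : ℂ} (hq : ‖q‖ < 1) : DifferentiableAt ℂ PP q :=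
  PP_diffOn.differentiableAt (Metric.isOpen_ball.mem_nhds (by simpa using hq))

lemma LL_diffAt {q : ℂ} (hq : ‖q‖ < 1) : DifferentiableAt ℂ LL q := by
  refine DifferentiableAt.div ?_ (PP_diffAt hq) (PP_ne hq)
  exact (PP_diffOn.deriv Metric.isOpen_ball).differentiableAt
    (Metric.isOpen_ball.mem_nhds (by simpa using hq))

lemma PP_zero : PP 0 = 1 := by simp [PP]

lemma LL_zero : LL 0 = -1 := by
  have hl : ∀ n : ℕ, logDeriv (fun q : ℂ ↦ 1 - q ^ (n + 1)) 0 = if n = 0 then -1 else 0 := by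
    intro n
    rcases n with _ | n
    · simp [logDeriv]
    · simp [logDeriv]
  have h := logDeriv_tprod_eq_tsum (f := fun (n : ℕ) (q : ℂ) ↦ 1 - q ^ (n + 1))
    (s := Metric.ball 0 1) Metric.isOpen_ball (x := 0) (by simp) (by simp) (by fun_prop)
    (by
      simp only [hl]
      exact summable_of_hasFiniteSupport (Set.Finite.subset (Set.finite_singleton 0)
        (by intro x hx; by_contra h0; simp at h0; simp [h0] at hx)))
    ModularForm.multipliableLocallyUniformlyOn_one_sub_pow (by simp)
  simp only [hl] at h
  rw [tsum_ite_eq] at h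
  exact h

lemma PP_mult {q : ℂ} (hq : ‖q‖ < 1) : Multipliable fun n : ℕ ↦ 1 - q ^ (n + 1) :=
  ModularForm.multipliable_one_sub_pow hq

def OO (q : ℂ) : ℂ := ∏' n : ℕ, (1 - q ^ (2 * n + 1))

lemma OO_mult {q : ℂ} (hq : ‖q‖ < 1) : Multipliable fun n : ℕ ↦ 1 - q ^ (2 * n + 1) := by
  simp only [sub_eq_add_neg]
  apply multipliable_one_add_of_summable (f := fun n ↦ -q ^ (2 * n + 1))
  have := (summable_geometric_of_lt_one (norm_nonneg _) hq).comp_injective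
    (i := fun n : ℕ ↦ 2 * n + 1) (fun a b h ↦ by simpa using h)
  simpa [Function.comp_def] using this

lemma sq_lt {q : ℂ} (hq : ‖q‖ < 1) : ‖q ^ 2‖ < 1 := by
  rw [norm_pow]; exact pow_lt_one₀ (norm_nonneg q) hq (by norm_num)

lemma four_lt {q : ℂ} (hq : ‖q‖ < 1) : ‖q ^ 4‖ < 1 := by
  rw [norm_pow]; exact pow_lt_one₀ (norm_nonneg q) hq (by norm_num)

lemma PP_eq_OO {q : ℂ} (hq : ‖q‖ < 1) : PP q = OO q * PP (q ^ 2) := by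
  have h := tprod_even_mul_odd (f := fun n : ℕ ↦ 1 - q ^ (n + 1)) (OO_mult hq)
    (by
      refine (PP_mult (sq_lt hq)).congr fun n ↦ ?_
      rw [← pow_mul]; ring_nf)
  unfold PP OO
  rw [← h]
  congr 1
  refine tprod_congr fun n ↦ ?_
  rw [← pow_mul]; ring_nf

lemma OO_mul {q : ℂ} (hq : ‖q‖ < 1) : OO q * OO (-q) = OO (q ^ 2) := by
  unfold OO
  rw [← (OO_mult hq).tprod_mul (OO_mult (by simpa using hq))]
  refine tprod_congr fun n ↦ ?_
  rw [Odd.neg_pow ⟨n, rfl⟩, ← pow_mul]; ring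

lemma PP_identity {q : ℂ} (hq : ‖q‖ < 1) :
    PP q * PP (-q) * PP (q ^ 4) = PP (q ^ 2) ^ 3 := by
  have h1 := PP_eq_OO hq
  have h2 := PP_eq_OO (q := -q) (by simpa using hq)
  have h3 := PP_eq_OO (sq_lt hq)
  have h4 := OO_mul hq
  rw [neg_sq] at h2
  rw [← pow_mul] at h3
  norm_num at h3
  calc _ = (OO q * OO (-q)) * PP (q ^ 4) * PP (q ^ 2) ^ 2 := by rw [h1, h2]; ring
    _ = _ := by rw [h4, ← h3]; ring

lemma PP_hasDeriv {q : ℂ} (hq : ‖q‖ < 1) : HasDerivAt PP (LL q * PP q) q := by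
  have := (PP_diffAt hq).hasDerivAt
  rwa [show deriv PP q = LL q * PP q by unfold LL; field_simp [PP_ne hq]] at this

lemma LL_identity {q : ℂ} (hq : ‖q‖ < 1) :
    LL q - LL (-q) + 4 * q ^ 3 * LL (q ^ 4) = 6 * q * LL (q ^ 2) := by
  have hn : ‖-q‖ < 1 := by simpa using hq
  have d1 := PP_hasDeriv hq
  have d2 := (PP_hasDeriv hn).scomp q (hasDerivAt_neg q)
  have d3 := (PP_hasDeriv (four_lt hq)).scomp q (hasDerivAt_pow 4 q)
  have d4 := (PP_hasDeriv (sq_lt hq)).scomp q (hasDerivAt_pow 2 q)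
  have dl := (d1.mul d2).mul d3
  have dr := d4.pow 3
  have he : (PP * (PP ∘ Neg.neg) * (PP ∘ fun x ↦ x ^ 4)) =ᶠ[𝓝 q] (PP ∘ fun x ↦ x ^ 2) ^ 3 := by
    filter_upwards [Metric.isOpen_ball.mem_nhds (show q ∈ Metric.ball (0 : ℂ) 1 by simpa using hq)]
      with x hx
    simpa using PP_identity (q := x) (by simpa using hx)
  have := (dr.congr_of_eventuallyEq he).unique dl
  simp only [Function.comp, Pi.mul_apply, smul_eq_mul] at this
  norm_num at this
  have hid := PP_identity hq
  have h0 : PP (q ^ 2) ^ 3 ≠ 0 := pow_ne_zero _ (PP_ne (sq_lt hq))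
  apply mul_right_cancel₀ h0
  linear_combination -this - (LL q - LL (-q) + 4 * q ^ 3 * LL (q ^ 4)) * hid

lemma exp_lt {z : ℂ} (hz : 0 < z.im) : ‖Complex.exp (2 * Real.pi * I * z)‖ < 1 := by
  have := UpperHalfPlane.norm_exp_two_pi_I_lt_one ⟨z, hz⟩
  simpa using this

lemma eta_eq (z : ℂ) : dedekindEta z =
    Complex.exp (Real.pi * I * z / 12) * PP (Complex.exp (2 * Real.pi * I * z)) := by
  unfold dedekindEta PP
  congr 1
  refine tprod_congr fun n ↦ ?_
  rw [← Complex.exp_nat_mul]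
  congr 2
  push_cast; ring

lemma eta_eq' : dedekindEta = ModularForm.eta := by
  ext z
  unfold dedekindEta ModularForm.eta
  congr 1
  · unfold Function.Periodic.qParam
    congr 1
    push_cast; ring
  · refine tprod_congr fun n ↦ ?_
    rw [ModularForm.eta_q_eq_cexp]

lemma eta_ne {z : ℂ} (hz : 0 < z.im) : dedekindEta z ≠ 0 := by
  rw [eta_eq']; exact ModularForm.eta_ne_zero hz

lemma eta_deriv {z : ℂ} (hz : 0 < z.im) :
    HasDerivAt dedekindEta (Real.pi * I / 12 * ee z * dedekindEta z) z := by
  have d1 : HasDerivAt (fun z : ℂ ↦ Complex.exp (Real.pi * I * z / 12))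
      (Complex.exp (Real.pi * I * z / 12) * (Real.pi * I / 12)) z := by
    have := (((hasDerivAt_id z).const_mul (Real.pi * I : ℂ)).div_const 12).cexp
    simpa using this
  have d2 : HasDerivAt (fun z : ℂ ↦ Complex.exp (2 * Real.pi * I * z))
      (Complex.exp (2 * Real.pi * I * z) * (2 * Real.pi * I)) z := by
    have := ((hasDerivAt_id z).const_mul (2 * Real.pi * I : ℂ)).cexp
    simpa using this
  have d3 := (PP_hasDeriv (exp_lt hz)).scomp z d2
  have d4 := d1.mul d3
  have : dedekindEta = (fun z : ℂ ↦ Complex.exp (Real.pi * I * z / 12)) *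
    (PP ∘ (fun z : ℂ ↦ Complex.exp (2 * Real.pi * I * z))) := by
    ext z; simp [eta_eq]
  rw [eta_eq z, this]
  refine d4.congr_deriv ?_
  simp only [ee, GG, Function.comp, smul_eq_mul]
  ring

lemma ee_eq_E2 (z : UpperHalfPlane) : ee z = EisensteinSeries.E2 z := by
  have h := ModularForm.logDeriv_eta_eq_E2 z
  rw [← eta_eq', logDeriv_apply, (eta_deriv z.2).deriv] at h
  have h0 : dedekindEta (z : ℂ) ≠ 0 := eta_ne z.2
  have h1 : (Real.pi * I / 12 : ℂ) ≠ 0 := by simp [Real.pi_ne_zero]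
  have h2 : (Real.pi * I / 12 : ℂ) * ee z = Real.pi * I / 12 * EisensteinSeries.E2 z := by
    rw [← h]
    exact (mul_div_cancel_right₀ _ h0).symm
  exact mul_left_cancel₀ h1 h2

lemma im_S {z : ℂ} (hz : 0 < z.im) : 0 < (-1 / z).im := by
  have := (UpperHalfPlane.mk _ (UpperHalfPlane.im_inv_neg_coe_pos ⟨z, hz⟩)).2
  rwa [show -1 / z = (-z)⁻¹ by rw [inv_neg, neg_div, one_div]]

lemma ee_S {z : ℂ} (hz : 0 < z.im) :
    ee (-1 / z) = z ^ 2 * ee z + 6 * z / (Real.pi * I) := by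
  have h0 : z ≠ 0 := by rintro rfl; simp at hz
  obtain ⟨τ, rfl⟩ : ∃ τ : UpperHalfPlane, (τ : ℂ) = z := ⟨⟨z, hz⟩, rfl⟩
  have hE2 := congrFun (EisensteinSeries.E2_slash_action ModularGroup.S) τ
  simp only [one_div, UpperHalfPlane.modular_S_smul, ModularForm.SL_slash_def, ModularGroup.denom_S,
    Int.reduceNeg, zpow_neg, riemannZeta_two, mul_inv_rev, inv_div, Pi.sub_apply, Pi.smul_apply,
    EisensteinSeries.D2, ModularGroup.denom_S, smul_eq_mul, ← ee_eq_E2,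
    show ModularGroup.S 1 0 = 1 by simp [ModularGroup.S]] at hE2
  rw [show (-(τ : ℂ))⁻¹ = -1 / τ by rw [inv_neg, neg_div, one_div]] at hE2
  have hpi : (Real.pi : ℂ) ≠ 0 := by simp [Real.pi_ne_zero]
  have hI := Complex.I_ne_zero
  rw [zpow_ofNat] at hE2
  have h5 : ee (-1 / τ) = (ee (-1 / τ) * ((τ : ℂ) ^ 2)⁻¹) * (τ : ℂ) ^ 2 := by field_simp
  rw [h5, hE2]
  field_simp
  push_cast
  ring_nf
  try simp only [Complex.I_sq]
  try ring

lemma eta_S {z : ℂ} (hz : 0 < z.im) : dedekindEta (-1 / z) ^ 4 = - z ^ 2 * dedekindEta z ^ 4 := by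
  have h0 : z ≠ 0 := by rintro rfl; simp at hz
  have h := ModularForm.eta_comp_eq_csqrt_I_inv hz
  simp only [Function.comp, Pi.smul_apply, Pi.mul_apply, smul_eq_mul] at h
  have hs : ∀ w : ℂ, w ≠ 0 → Complex.sqrt w ^ 4 = w ^ 2 := by
    intro w hw
    rw [Complex.sqrt, Complex.cpow_def_of_ne_zero hw, ← Complex.exp_nat_mul]
    ring_nf
    rw [show (Complex.log w * 2) = (2 : ℕ) * Complex.log w by push_cast; ring, Complex.exp_nat_mul,
      Complex.exp_log hw]
  rw [eta_eq', h, mul_pow, mul_pow, inv_pow, hs _ h0, hs _ I_ne_zero, I_sq]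
  ring

end LambdaAux

noncomputable section LambdaAux2

def HF (q : ℂ) : ℂ := (GG q + 8 * GG (q ^ 4) - 6 * GG (q ^ 2)) / 3 * PP (q ^ 2) ^ 4 / PP q ^ 8

def HT (q : ℂ) : ℂ :=
  -(4 * q ^ 3 * LL (q ^ 4) + 2 * LL q - 6 * q * LL (q ^ 2)) / 2 * PP (q ^ 2) ^ 4 / PP (q ^ 4) ^ 8

def QQ (z : ℂ) : ℂ := Complex.exp (Real.pi * I * z)

lemma HF_zero : HF 0 = 1 := by
  simp [HF, GG, PP_zero]; norm_num

lemma HT_zero : HT 0 = 1 := by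
  simp [HT, LL_zero, PP_zero]

lemma HT_even {q : ℂ} (hq : ‖q‖ < 1) : HT (-q) = HT q := by
  have h := LL_identity hq
  have h4 : (-q) ^ 4 = q ^ 4 := by ring
  unfold HT
  rw [neg_sq, h4]
  congr 2
  linear_combination h

lemma QQ_lt {z : ℂ} (hz : 0 < z.im) : ‖QQ z‖ < 1 := by
  unfold QQ
  rw [Complex.norm_exp]
  simp
  positivity

lemma QQ_ne (z : ℂ) : QQ z ≠ 0 := Complex.exp_ne_zero _

lemma QQ_half (z : ℂ) : Complex.exp (2 * Real.pi * I * (z / 2)) = QQ z := by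
  unfold QQ; congr 1; ring

lemma QQ_one (z : ℂ) : Complex.exp (2 * Real.pi * I * z) = QQ z ^ 2 := by
  unfold QQ; rw [← Complex.exp_nat_mul]; congr 1; push_cast; ring

lemma QQ_two (z : ℂ) : Complex.exp (2 * Real.pi * I * (2 * z)) = QQ z ^ 4 := by
  unfold QQ; rw [← Complex.exp_nat_mul]; congr 1; push_cast; ring

lemma QQ_add_one (z : ℂ) : QQ (z + 1) = - QQ z := by
  unfold QQ
  rw [mul_add, Complex.exp_add, mul_one, Complex.exp_pi_mul_I]; ring

lemma QQ_sub_one (z : ℂ) : QQ (z - 1) = - QQ z := by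
  have := QQ_add_one (z - 1)
  rw [sub_add_cancel] at this
  rw [this, neg_neg]

lemma half_im {z : ℂ} (hz : 0 < z.im) : 0 < (z / 2).im := by
  have : (z / 2).im = z.im / 2 := by
    rw [show (2 : ℂ) = ((2 : ℝ) : ℂ) by norm_num, Complex.div_ofReal_im]
  rw [this]; positivity

lemma two_im {z : ℂ} (hz : 0 < z.im) : 0 < (2 * z).im := by
  simp; exact hz

lemma HF_eq {z : ℂ} (hz : 0 < z.im) : HF (QQ z) =
    (ee (z / 2) + 8 * ee (2 * z) - 6 * ee z) / 3 * dedekindEta z ^ 4 / dedekindEta (z / 2) ^ 8 := by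
  have h1 := PP_ne (QQ_lt hz)
  unfold HF ee
  rw [eta_eq, eta_eq, QQ_half, QQ_two z, QQ_one z, mul_pow, mul_pow, ← Complex.exp_nat_mul,
    ← Complex.exp_nat_mul]
  rw [show ((4 : ℕ) : ℂ) * (Real.pi * I * z / 12) = Real.pi * I * z / 3 by push_cast; ring,
    show ((8 : ℕ) : ℂ) * (Real.pi * I * (z / 2) / 12) = Real.pi * I * z / 3 by push_cast; ring]
  have := Complex.exp_ne_zero (Real.pi * I * z / 3)
  field_simp

lemma HT_eq {z : ℂ} (hz : 0 < z.im) : HT (QQ z) =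
    -(4 * ee (2 * z) + 2 * ee (z / 2) - 6 * ee z) / 3 * dedekindEta z ^ 4 /
      (16 * dedekindEta (2 * z) ^ 8) := by
  have h1 := PP_ne (four_lt (QQ_lt hz))
  unfold HT ee
  rw [eta_eq, eta_eq, QQ_half, QQ_two z, QQ_one z, mul_pow, mul_pow, ← Complex.exp_nat_mul,
    ← Complex.exp_nat_mul]
  rw [show ((4 : ℕ) : ℂ) * (Real.pi * I * z / 12) = Real.pi * I * z / 3 by push_cast; ring,
    show ((8 : ℕ) : ℂ) * (Real.pi * I * (2 * z) / 12) = Real.pi * I * z / 3 + Real.pi * I * z by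
      push_cast; ring, Complex.exp_add]
  change _ = _ / (16 * (_ * QQ z * _))
  have := Complex.exp_ne_zero (Real.pi * I * z / 3)
  have := QQ_ne z
  unfold GG
  field_simp
  ring

lemma HF_S {z : ℂ} (hz : 0 < z.im) : HF (QQ (-1 / z)) = HT (QQ z) := by
  have h0 : z ≠ 0 := by rintro rfl; simp at hz
  rw [HF_eq (im_S hz), HT_eq hz]
  have e1 := ee_S hz
  have e2 := ee_S (half_im hz)
  have e3 := ee_S (two_im hz)
  have n1 := eta_S hz
  have n3 := eta_S (two_im hz)
  rw [show -1 / z / 2 = -1 / (2 * z) by field_simp, show 2 * (-1 / z) = -1 / (z / 2) by field_simp,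
    e1, e2, e3, n1, show dedekindEta (-1 / (2 * z)) ^ 8 = (dedekindEta (-1 / (2 * z)) ^ 4) ^ 2 by ring,
    n3]
  have := eta_ne (two_im hz)
  have hpi : (Real.pi : ℂ) ≠ 0 := by simp [Real.pi_ne_zero]
  have hI := Complex.I_ne_zero
  field_simp
  ring

lemma HT_S {z : ℂ} (hz : 0 < z.im) : HT (QQ (-1 / z)) = HF (QQ z) := by
  have h0 : z ≠ 0 := by rintro rfl; simp at hz
  rw [← HF_S (im_S hz)]
  congr 2
  field_simp

lemma HFn_S {z : ℂ} (hz : 0 < z.im) : HF (-QQ (-1 / z)) = HF (-QQ z) := by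
  have h0 : z ≠ 0 := by rintro rfl; simp at hz
  have hz1 : 0 < (z - 1).im := by simpa using hz
  have h1 : z - 1 ≠ 0 := by intro h; rw [h] at hz1; simp at hz1
  have hs := im_S hz1
  have hw : 0 < (-1 / (z - 1) - 1).im := by simpa using hs
  have hk : -1 / (z - 1) - 1 ≠ 0 := by intro h; rw [h] at hw; simp at hw
  have hk2 : -1 / (z - 1) - 1 = -z / (z - 1) := by field_simp; ring
  have e : -1 / z + 1 = -1 / (-1 / (z - 1) - 1) := by
    rw [hk2]; field_simp; ring
  rw [← QQ_add_one, e, HF_S hw, QQ_sub_one, HT_even (QQ_lt hs), HT_S hz1, QQ_sub_one]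

lemma HF_diffAt {q : ℂ} (hq : ‖q‖ < 1) : DifferentiableAt ℂ HF q := by
  have a1 := LL_diffAt hq
  have a2 : DifferentiableAt ℂ (fun q ↦ LL (q ^ 2)) q :=
    (LL_diffAt (sq_lt hq)).comp q (differentiableAt_pow 2)
  have a4 : DifferentiableAt ℂ (fun q ↦ LL (q ^ 4)) q :=
    (LL_diffAt (four_lt hq)).comp q (differentiableAt_pow 4)
  have b1 := PP_diffAt hq
  have b2 : DifferentiableAt ℂ (fun q ↦ PP (q ^ 2)) q :=
    (PP_diffAt (sq_lt hq)).comp q (differentiableAt_pow 2)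
  have hne := pow_ne_zero 8 (PP_ne hq)
  unfold HF GG
  fun_prop (disch := assumption)

lemma HT_diffAt {q : ℂ} (hq : ‖q‖ < 1) : DifferentiableAt ℂ HT q := by
  have a1 := LL_diffAt hq
  have a2 : DifferentiableAt ℂ (fun q ↦ LL (q ^ 2)) q :=
    (LL_diffAt (sq_lt hq)).comp q (differentiableAt_pow 2)
  have a4 : DifferentiableAt ℂ (fun q ↦ LL (q ^ 4)) q :=
    (LL_diffAt (four_lt hq)).comp q (differentiableAt_pow 4)
  have b4 : DifferentiableAt ℂ (fun q ↦ PP (q ^ 4)) q :=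
    (PP_diffAt (four_lt hq)).comp q (differentiableAt_pow 4)
  have b2 : DifferentiableAt ℂ (fun q ↦ PP (q ^ 2)) q :=
    (PP_diffAt (sq_lt hq)).comp q (differentiableAt_pow 2)
  have hne := pow_ne_zero 8 (PP_ne (four_lt hq))
  unfold HT
  fun_prop (disch := assumption)

def FF (t q : ℂ) : ℂ := (HF q - t) * (HF (-q) - t) * (HT q - t)

lemma FF_diffAt (t : ℂ) {q : ℂ} (hq : ‖q‖ < 1) : DifferentiableAt ℂ (FF t) q := by
  have a1 := HF_diffAt hq
  have a2 : DifferentiableAt ℂ (fun q ↦ HF (-q)) q :=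
    (HF_diffAt (q := -q) (by simpa using hq)).comp q (by fun_prop)
  have a3 := HT_diffAt hq
  unfold FF
  fun_prop

def FH (t : ℂ) (τ : UpperHalfPlane) : ℂ := FF t (QQ τ)

open UpperHalfPlane MatrixGroups ModularForm in
lemma FH_T (t : ℂ) : (FH t) ∣[(0 : ℤ)] ModularGroup.T = FH t := by
  ext τ
  rw [ModularForm.SL_slash_apply, UpperHalfPlane.modular_T_smul]
  simp only [neg_zero, zpow_zero, mul_one, FH]
  have : (((1 : ℝ) +ᵥ τ : UpperHalfPlane) : ℂ) = τ + 1 := by simp [add_comm]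
  rw [this, QQ_add_one, FF, FF, HT_even (QQ_lt τ.2), neg_neg]
  ring

open UpperHalfPlane MatrixGroups ModularForm in
lemma FH_S (t : ℂ) : (FH t) ∣[(0 : ℤ)] ModularGroup.S = FH t := by
  ext τ
  rw [ModularForm.SL_slash_apply, UpperHalfPlane.modular_S_smul]
  simp only [neg_zero, zpow_zero, mul_one, FH]
  rw [show (-(τ : ℂ))⁻¹ = -1 / τ by rw [inv_neg, neg_div, one_div], FF, FF, HF_S τ.2, HFn_S τ.2,
    HT_S τ.2]
  ring

lemma FH_tendsto (t : ℂ) :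
    Tendsto (FH t) UpperHalfPlane.atImInfty (𝓝 ((1 - t) ^ 3)) := by
  have h1 : Tendsto (fun τ : UpperHalfPlane ↦ QQ τ) UpperHalfPlane.atImInfty (𝓝 0) := by
    have := UpperHalfPlane.qParam_tendsto_atImInfty (h := 2) (by norm_num)
    refine this.congr fun τ ↦ ?_
    unfold QQ Function.Periodic.qParam
    congr 1
    push_cast; ring
  have h2 := (FF_diffAt t (q := 0) (by simp)).continuousAt.tendsto
  have h3 : FF t 0 = (1 - t) ^ 3 := by
    simp [FF, HF_zero, HT_zero]; ring
  rw [h3] at h2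
  exact h2.comp h1

open UpperHalfPlane MatrixGroups ModularForm in
def FM (t : ℂ) : ModularForm 𝒮ℒ 0 where
  toFun := FH t
  slash_action_eq' A hA := by
    obtain ⟨A, rfl⟩ := hA
    exact SlashInvariantForm.slash_action_generators_SL2Z (FH_S t) (FH_T t) A
  holo' := by
    rw [UpperHalfPlane.mdifferentiable_iff]
    have : DifferentiableOn ℂ (fun z ↦ FF t (QQ z)) {z | 0 < z.im} := fun z hz ↦ by
      refine DifferentiableAt.differentiableWithinAt ?_
      refine (FF_diffAt t (QQ_lt hz)).comp z ?_
      unfold QQ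
      fun_prop
    refine this.congr fun z hz ↦ ?_
    simp [FH, ofComplex_apply_of_im_pos hz]
  bdd_at_cusps' hc := by
    rw [Subgroup.IsArithmetic.isCusp_iff_isCusp_SL2Z] at hc
    rw [OnePoint.isBoundedAt_iff_forall_SL2Z hc]
    intro γ _
    rw [SlashInvariantForm.slash_action_generators_SL2Z (FH_S t) (FH_T t)]
    exact (FH_tendsto t).isBigO_one ℝ

lemma FH_eq (t : ℂ) (τ : UpperHalfPlane) : FH t τ = (1 - t) ^ 3 := by
  obtain ⟨c, hc⟩ := ModularFormClass.levelOne_weight_zero_const (FM t)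
  have hc' : FH t = Function.const _ c := hc
  have h := FH_tendsto t
  rw [hc'] at h ⊢
  exact tendsto_nhds_unique tendsto_const_nhds h

lemma HF_one {z : ℂ} (hz : 0 < z.im) : HF (QQ z) = 1 := by
  have h := FH_eq (HF (QQ z)) ⟨z, hz⟩
  simp only [FH, FF, sub_self, zero_mul] at h
  have := pow_eq_zero_iff (by norm_num) |>.mp h.symm
  linear_combination -this

lemma ee_identity {z : ℂ} (hz : 0 < z.im) :
    (ee (z / 2) + 8 * ee (2 * z) - 6 * ee z) * dedekindEta z ^ 4 =
      3 * dedekindEta (z / 2) ^ 8 := by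
  have h := HF_one hz
  rw [HF_eq hz] at h
  have := eta_ne (half_im hz)
  field_simp at h
  rw [mul_comm z 2] at h
  linear_combination h

end LambdaAux2

theorem deriv_modularLambda (z : ℂ) (hz : 0 < z.im) :
    deriv modularLambda z =
      16 * Real.pi * I * dedekindEta (z / 2) ^ 16 * dedekindEta (2 * z) ^ 16 /
        dedekindEta z ^ 28 := by
  have n1 := eta_ne hz
  have d1 := eta_deriv hz
  have d2 := (eta_deriv (half_im hz)).scomp z ((hasDerivAt_id z).div_const 2)
  have d3 := (eta_deriv (two_im hz)).scomp z ((hasDerivAt_id z).const_mul 2)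
  have d := (((d2.pow 8).const_mul 16).mul (d3.pow 16)).div (d1.pow 24) (pow_ne_zero _ n1)
  have hd : HasDerivAt modularLambda _ z := d
  rw [hd.deriv]
  simp only [Function.comp, Pi.mul_apply, Pi.pow_apply, smul_eq_mul, id]
  have h := ee_identity hz
  rw [div_eq_div_iff (by positivity) (by positivity)]
  push_cast
  norm_num
  linear_combination (16 * Real.pi * I / 3 * dedekindEta (z / 2) ^ 8 * dedekindEta (2 * z) ^ 16 *
    dedekindEta z ^ 48) * h
end

section
/- For all z in the upper half-plane, the derivative of z ↦ λ(z)·η(z)^4/λ'(z) equals η(z)^4·(1+λ(z))/(3·(1−λ(z))), where λ is the modular lambda function and η the Dedekind eta function. -/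
open Complex

namespace LamProof

open Filter Topology MatrixGroups
open UpperHalfPlane hiding I
open scoped ModularForm

/-- Level one, weight zero functions with a limit at infinity are constant. -/
lemma const_of_inv (f : ℂ → ℂ) (L : ℂ) (hd : ∀ z : ℂ, 0 < z.im → DifferentiableAt ℂ f z)
    (hS : ∀ z : ℂ, 0 < z.im → f (-1 / z) = f z) (hT : ∀ z : ℂ, 0 < z.im → f (z + 1) = f z)
    (hL : Tendsto (fun z : ℍ => f z) atImInfty (𝓝 L)) (z : ℂ) (hz : 0 < z.im) : f z = L := by
  set g : ℍ → ℂ := fun z => f z with hg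
  have gS : g ∣[(0 : ℤ)] ModularGroup.S = g := by
    ext w
    rw [ModularForm.SL_slash_apply, UpperHalfPlane.modular_S_smul]
    have := hS w w.2
    rw [neg_div, one_div] at this
    simp [hg, ← this, inv_neg]
  have gT : g ∣[(0 : ℤ)] ModularGroup.T = g := by
    ext w
    rw [ModularForm.SL_slash_apply, UpperHalfPlane.modular_T_smul]
    have := hT w w.2
    simp [hg, ← this, add_comm]
  have gall := SlashInvariantForm.slash_action_generators_SL2Z gS gT
  let G : ModularForm 𝒮ℒ 0 :=
    { toFun := g
      slash_action_eq' := by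
        intro A hA
        obtain ⟨A, rfl⟩ := hA
        exact gall A
      holo' := by
        rw [UpperHalfPlane.mdifferentiable_iff]
        refine .congr (fun z hz ↦ (hd z hz).differentiableWithinAt) fun z hz ↦ ?_
        simp [hg, ofComplex_apply_of_im_pos hz]
      bdd_at_cusps' := by
        intro c hc
        rw [Subgroup.IsArithmetic.isCusp_iff_isCusp_SL2Z] at hc
        rw [OnePoint.isBoundedAt_iff_forall_SL2Z hc]
        intro γ _
        rw [gall γ]
        exact hL.isBigO_one ℝ }
  obtain ⟨c, hc⟩ := ModularFormClass.levelOne_weight_zero_const G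
  have hc' : g = fun _ => c := hc
  have : Tendsto g atImInfty (𝓝 L) := hL
  rw [hc'] at this
  have h2 := tendsto_nhds_unique this tendsto_const_nhds
  have h3 := congrFun hc' ⟨z, hz⟩
  simp only [hg] at h3
  rw [h2, ← h3]

/-- Euler product. -/
noncomputable def F (q : ℂ) : ℂ := ∏' n : ℕ, (1 - q ^ (n + 1))

lemma F_diff : DifferentiableOn ℂ F (Metric.ball 0 1) :=
  ModularForm.differentiableOn_tprod_one_sub_pow

lemma F_ne {q : ℂ} (hq : q ∈ Metric.ball (0 : ℂ) 1) : F q ≠ 0 := by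
  have hq' : ‖q‖ < 1 := by simpa using hq
  unfold F
  simp_rw [sub_eq_add_neg]
  refine tprod_one_add_ne_zero_of_summable (f := fun n ↦ -q ^ (n + 1)) ?_ ?_
  · intro i h
    have h1 : q ^ (i + 1) = 1 := by linear_combination -h
    have h2 : ‖q‖ ^ (i + 1) = 1 := by rw [← norm_pow, h1, norm_one]
    have := pow_lt_one₀ (norm_nonneg q) hq' (Nat.succ_ne_zero i)
    exact absurd h2 this.ne
  · simpa using (summable_nat_add_iff 1).mpr (summable_geometric_of_lt_one (norm_nonneg _) hq')

lemma F_zero : F 0 = 1 := by simp [F]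

/-- log derivative of the product -/
noncomputable def K (q : ℂ) : ℂ := logDeriv F q

lemma K_diff : DifferentiableOn ℂ K (Metric.ball 0 1) :=
  (F_diff.deriv Metric.isOpen_ball).div F_diff fun _ h => F_ne h

lemma K_zero : K 0 = -1 := by
  have key : ∀ i : ℕ, logDeriv (fun q : ℂ => 1 - q ^ (i + 1)) 0 = if i = 0 then -1 else 0 := by
    intro i
    rcases i with _ | i <;> simp [logDeriv_apply]
  have := logDeriv_tprod_eq_tsum (s := Metric.ball (0:ℂ) 1) Metric.isOpen_ball (x := 0) (by simp)
    (f := fun (n : ℕ) (q : ℂ) => 1 - q ^ (n + 1)) (by simp) (fun i => by fun_prop)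
    (by
      simp_rw [key]
      exact summable_of_hasFiniteSupport ((Set.finite_singleton 0).subset (by
        intro i; simp)))
    ModularForm.multipliableLocallyUniformlyOn_one_sub_pow (F_ne (by simp))
  unfold K F
  rw [this]
  simp_rw [key]
  simp

/-- The function `E₂` in terms of `q`. -/
noncomputable def E (q : ℂ) : ℂ := 1 + 24 * q * K q

lemma E_diff : DifferentiableOn ℂ E (Metric.ball 0 1) := by
  unfold E
  exact (((differentiableOn_id.const_mul 24).mul K_diff).const_add 1)

lemma E_zero : E 0 = 1 := by simp [E]

lemma eta_eq (z : ℂ) : ModularForm.eta z = cexp (Real.pi * I * z / 12) * F (cexp (2 * Real.pi * I * z)) := by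
  unfold ModularForm.eta F
  simp only [ModularForm.eta_q_eq_pow]
  congr 1
  simp only [Function.Periodic.qParam]
  congr 1
  push_cast
  ring

lemma ded_eq (z : ℂ) : dedekindEta z = ModularForm.eta z := by
  unfold dedekindEta
  rw [eta_eq, F]
  congr 2
  ext n
  rw [← Complex.exp_nat_mul]
  congr 2
  push_cast
  ring

/-- `E₂` in terms of `z`. -/
noncomputable def e (z : ℂ) : ℂ := logDeriv ModularForm.eta z * (12 / (Real.pi * I))

lemma exp_mem (c : ℝ) (hc : 0 < c) (z : ℂ) (hz : 0 < z.im) :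
    cexp (c * I * z) ∈ Metric.ball (0 : ℂ) 1 := by
  simp [Complex.norm_exp]
  positivity

lemma eta_diff {z : ℂ} (hz : 0 < z.im) : DifferentiableAt ℂ ModularForm.eta z :=
  ModularForm.differentiableAt_eta_of_mem_upperHalfPlaneSet hz

lemma eta_ne {z : ℂ} (hz : 0 < z.im) : ModularForm.eta z ≠ 0 :=
  ModularForm.eta_ne_zero hz

lemma piI : (Real.pi : ℂ) * I ≠ 0 := by simp [Real.pi_ne_zero]

lemma eta_hasDeriv {z : ℂ} (hz : 0 < z.im) :
    HasDerivAt ModularForm.eta (Real.pi * I / 12 * e z * ModularForm.eta z) z := by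
  refine (eta_diff hz).hasDerivAt.congr_deriv ?_
  have := eta_ne hz
  have := piI
  rw [e, logDeriv_apply]
  field_simp

lemma e_eq {z : ℂ} (hz : 0 < z.im) : e z = E (cexp (2 * Real.pi * I * z)) := by
  have hq := exp_mem (2 * Real.pi) (by positivity) z hz
  push_cast at hq
  have hF := (F_diff.differentiableAt (Metric.isOpen_ball.mem_nhds hq)).hasDerivAt
  have hFn := F_ne hq
  have h1 : HasDerivAt (fun z : ℂ => cexp (2 * Real.pi * I * z))
      (cexp (2 * Real.pi * I * z) * (2 * Real.pi * I)) z := by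
    simpa using ((hasDerivAt_id z).const_mul (2 * (Real.pi : ℂ) * I)).cexp
  have h2 : HasDerivAt (fun z : ℂ => cexp (Real.pi * I * z / 12))
      (cexp (Real.pi * I * z / 12) * (Real.pi * I / 12)) z := by
    simpa using (((hasDerivAt_id z).const_mul ((Real.pi : ℂ) * I)).div_const 12).cexp
  have h3 := h2.mul (hF.comp z h1)
  have h4 : ModularForm.eta = (fun z : ℂ => cexp (Real.pi * I * z / 12)) *
      (F ∘ (fun z : ℂ => cexp (2 * Real.pi * I * z))) := by
    ext z; simp [eta_eq]
  rw [← h4] at h3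
  have h5 := h3.unique (eta_hasDeriv hz)
  have hx := Complex.exp_ne_zero (Real.pi * I * z / 12)
  have := piI
  rw [eta_eq] at h5
  simp only [E, K, logDeriv_apply, Function.comp] at h5 ⊢
  generalize cexp (Real.pi * I * z / 12) = x at *
  generalize cexp (2 * Real.pi * I * z) = q at *
  field_simp
  have h6 : (x * (Real.pi * I)) * (e z * F q) = (x * (Real.pi * I)) * (F q + 24 * q * deriv F q) := by
    linear_combination -12 * h5
  exact mul_left_cancel₀ (mul_ne_zero hx this) h6

/-- `exp(πi/3)` -/
noncomputable def ζ : ℂ := cexp (Real.pi * I / 3)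

lemma ζ3 : ζ ^ 3 = -1 := by
  rw [ζ, ← Complex.exp_nat_mul, ← Complex.exp_pi_mul_I]
  congr 1; push_cast; ring

lemma ζ_ne : ζ ≠ 0 := Complex.exp_ne_zero _

lemma eta_T (z : ℂ) : ModularForm.eta (z + 1) = cexp (Real.pi * I / 12) * ModularForm.eta z := by
  rw [eta_eq, eta_eq, ← mul_assoc, ← Complex.exp_add]
  congr 2
  · ring
  · rw [mul_add, Complex.exp_add, mul_one, Complex.exp_two_pi_mul_I, mul_one]

lemma eta_T4 (z : ℂ) : ModularForm.eta (z + 1) ^ 4 = ζ * ModularForm.eta z ^ 4 := by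
  rw [eta_T, mul_pow, ← Complex.exp_nat_mul, ζ]
  congr 2; push_cast; ring

lemma eta_T8 (z : ℂ) : ModularForm.eta (z + 1) ^ 8 = ζ ^ 2 * ModularForm.eta z ^ 8 := by
  linear_combination (ModularForm.eta (z + 1) ^ 4 + ζ * ModularForm.eta z ^ 4) * eta_T4 z

lemma e_T {z : ℂ} (hz : 0 < z.im) : e (z + 1) = e z := by
  rw [e_eq hz, e_eq (by simpa using hz)]
  rw [mul_add, Complex.exp_add, mul_one, Complex.exp_two_pi_mul_I, mul_one]

lemma sqrt_sq' (z : ℂ) : Complex.sqrt z ^ 2 = z := by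
  rw [Complex.sqrt, ← Complex.cpow_nat_mul]
  norm_num

lemma S_im {z : ℂ} (hz : 0 < z.im) : 0 < (-1 / z).im := by
  have : z ≠ 0 := by rintro rfl; simp at hz
  rw [neg_div, one_div, neg_im, Complex.inv_im, neg_div, neg_neg]
  exact div_pos hz (Complex.normSq_pos.2 this)

lemma eta_S4 {z : ℂ} (hz : 0 < z.im) :
    ModularForm.eta (-1 / z) ^ 4 = - z ^ 2 * ModularForm.eta z ^ 4 := by
  have h := ModularForm.eta_comp_eq_csqrt_I_inv hz
  simp only [Function.comp, Pi.smul_apply, Pi.mul_apply, smul_eq_mul] at h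
  rw [h, mul_pow, mul_pow, inv_pow, show Complex.sqrt I ^ 4 = (Complex.sqrt I ^ 2) ^ 2 by ring,
    show Complex.sqrt z ^ 4 = (Complex.sqrt z ^ 2) ^ 2 by ring, sqrt_sq', sqrt_sq', I_sq]
  ring_nf

lemma eta_S8 {z : ℂ} (hz : 0 < z.im) :
    ModularForm.eta (-1 / z) ^ 8 = z ^ 4 * ModularForm.eta z ^ 8 := by
  linear_combination (ModularForm.eta (-1 / z) ^ 4 - z ^ 2 * ModularForm.eta z ^ 4) * eta_S4 hz

lemma e_S {z : ℂ} (hz : 0 < z.im) : e (-1 / z) = z ^ 2 * e z + 6 * z / (Real.pi * I) := by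
  have hz0 : z ≠ 0 := by rintro rfl; simp at hz
  have h1 : HasDerivAt (fun w : ℂ => -1 / w) (1 / z ^ 2) z := by
    have := (hasDerivAt_inv hz0).neg
    simp only [neg_neg] at this
    convert! this using 1
    · ext w; simp [neg_div]
    · simp
  have h2 := ((eta_hasDeriv (S_im hz)).comp z h1).pow 4
  have h3 := ((hasDerivAt_id z).pow 2).neg.mul ((eta_hasDeriv hz).pow 4)
  have h4 : (ModularForm.eta ∘ fun w : ℂ => -1 / w) ^ 4 =ᶠ[𝓝 z] -(id ^ 2) * ModularForm.eta ^ 4 := by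
    filter_upwards [isOpen_upperHalfPlaneSet.mem_nhds hz] with w hw
    simpa using eta_S4 hw
  have h5 := h2.unique (h3.congr_of_eventuallyEq h4)
  have := eta_ne hz
  have h7 := piI
  have h8 := eta_S4 hz
  simp [-neg_mul] at h5
  have h9 : (z ^ 2)⁻¹ * (Real.pi * I / 3 * e (-1 / z)) * ModularForm.eta (-1 / z) ^ 4 =
    (-(2 * z) - z ^ 2 * (Real.pi * I / 3 * e z)) * ModularForm.eta z ^ 4 := by
    linear_combination h5
  rw [h8] at h9
  have h10 := mul_right_cancel₀ (pow_ne_zero 4 this) (by linear_combination h9 :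
    ((z ^ 2)⁻¹ * (Real.pi * I / 3 * e (-1 / z)) * (-z ^ 2)) * ModularForm.eta z ^ 4 =
    (-(2 * z) - z ^ 2 * (Real.pi * I / 3 * e z)) * ModularForm.eta z ^ 4)
  field_simp at h10 ⊢
  linear_combination -h10


/-- The three weight-zero quotients, in terms of the nome. -/
noncomputable def r1 (p : ℂ) : ℂ := F (p ^ 2) ^ 4 * (4 * E (p ^ 4) - E (-p)) / F p ^ 8

/-- The second quotient. -/
noncomputable def r2 (p : ℂ) : ℂ := F (p ^ 2) ^ 4 * (-(3 / 2) * (K p + K (-p))) / F (p ^ 4) ^ 8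

lemma ball_pow {p : ℂ} (hp : p ∈ Metric.ball (0 : ℂ) 1) (n : ℕ) (hn : n ≠ 0) :
    p ^ n ∈ Metric.ball (0 : ℂ) 1 := by
  simp only [mem_ball_zero_iff, norm_pow] at hp ⊢
  exact pow_lt_one₀ (norm_nonneg _) hp hn

lemma ball_neg {p : ℂ} (hp : p ∈ Metric.ball (0 : ℂ) 1) : -p ∈ Metric.ball (0 : ℂ) 1 := by
  simpa using hp

lemma dAt {f : ℂ → ℂ} (hf : DifferentiableOn ℂ f (Metric.ball 0 1)) {p : ℂ}
    (hp : p ∈ Metric.ball (0 : ℂ) 1) : DifferentiableAt ℂ f p :=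
  hf.differentiableAt (Metric.isOpen_ball.mem_nhds hp)

lemma dPow {f : ℂ → ℂ} (hf : DifferentiableOn ℂ f (Metric.ball 0 1)) {p : ℂ}
    (hp : p ∈ Metric.ball (0 : ℂ) 1) (n : ℕ) (hn : n ≠ 0) :
    DifferentiableAt ℂ (fun p => f (p ^ n)) p :=
  DifferentiableAt.comp p (dAt hf (ball_pow hp n hn)) (by fun_prop)

lemma dNeg {f : ℂ → ℂ} (hf : DifferentiableOn ℂ f (Metric.ball 0 1)) {p : ℂ}
    (hp : p ∈ Metric.ball (0 : ℂ) 1) :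
    DifferentiableAt ℂ (fun p => f (-p)) p :=
  DifferentiableAt.comp p (dAt hf (ball_neg hp)) (by fun_prop)

lemma r1_diff {p : ℂ} (hp : p ∈ Metric.ball (0 : ℂ) 1) : DifferentiableAt ℂ r1 p :=
  (((dPow F_diff hp 2 (by simp)).pow 4).mul
    (((dPow E_diff hp 4 (by simp)).const_mul 4).sub (dNeg E_diff hp))).div
    ((dAt F_diff hp).pow 8) (pow_ne_zero _ (F_ne hp))

lemma r1neg_diff {p : ℂ} (hp : p ∈ Metric.ball (0 : ℂ) 1) :
    DifferentiableAt ℂ (fun p => r1 (-p)) p :=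
  DifferentiableAt.comp p (r1_diff (ball_neg hp)) (by fun_prop)

lemma r2_diff {p : ℂ} (hp : p ∈ Metric.ball (0 : ℂ) 1) : DifferentiableAt ℂ r2 p :=
  (((dPow F_diff hp 2 (by simp)).pow 4).mul
    (((dAt K_diff hp).add (dNeg K_diff hp)).const_mul _)).div
    ((dPow F_diff hp 4 (by simp)).pow 8) (pow_ne_zero _ (F_ne (ball_pow hp 4 (by simp))))

lemma r1_zero : r1 0 = 3 := by
  simp [r1, F_zero, E_zero]; norm_num

lemma r2_zero : r2 0 = 3 := by
  simp [r2, F_zero, K_zero]; norm_num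

/-- The nome `exp(πiz)`. -/
noncomputable def p (z : ℂ) : ℂ := cexp (Real.pi * I * z)

lemma p_mem {z : ℂ} (hz : 0 < z.im) : p z ∈ Metric.ball (0 : ℂ) 1 :=
  exp_mem Real.pi Real.pi_pos z hz

lemma p_diff (z : ℂ) : DifferentiableAt ℂ p z := by
  unfold p; fun_prop

lemma p_tendsto : Tendsto (fun z : ℍ => p z) atImInfty (𝓝 0) := by
  have := UpperHalfPlane.qParam_tendsto_atImInfty (h := 2) (by norm_num)
  refine this.congr fun z => ?_
  simp only [Function.Periodic.qParam, p]
  congr 1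
  push_cast
  ring

lemma tendsto_p {f : ℂ → ℂ} (hf : DifferentiableAt ℂ f 0) :
    Tendsto (fun z : ℍ => f (p z)) atImInfty (𝓝 (f 0)) :=
  hf.continuousAt.tendsto.comp p_tendsto

/-- `E₂(z/2)` -/
noncomputable def a (z : ℂ) : ℂ := e (z / 2)
/-- `E₂((z+1)/2)` -/
noncomputable def b (z : ℂ) : ℂ := e ((z + 1) / 2)
/-- `4E₂(2z)` -/
noncomputable def c (z : ℂ) : ℂ := 4 * e (2 * z)
/-- `η(z/2)^8` -/
noncomputable def A (z : ℂ) : ℂ := ModularForm.eta (z / 2) ^ 8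
/-- `η((z+1)/2)^8` -/
noncomputable def B (z : ℂ) : ℂ := ModularForm.eta ((z + 1) / 2) ^ 8
/-- `16η(2z)^8` -/
noncomputable def C (z : ℂ) : ℂ := 16 * ModularForm.eta (2 * z) ^ 8
/-- `η(z)^4` -/
noncomputable def D (z : ℂ) : ℂ := ModularForm.eta z ^ 4

lemma im_half {z : ℂ} (hz : 0 < z.im) : 0 < (z / 2).im := by
  have : (z / 2).im = z.im / 2 := by simp
  rw [this]; positivity

lemma im_half' {z : ℂ} (hz : 0 < z.im) : 0 < ((z + 1) / 2).im :=
  im_half (by simpa using hz)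

lemma im_two {z : ℂ} (hz : 0 < z.im) : 0 < (2 * z).im := by
  simpa using hz

lemma im_add {z : ℂ} (hz : 0 < z.im) : 0 < (z + 1).im := by
  simpa using hz

lemma A_ne {z : ℂ} (hz : 0 < z.im) : A z ≠ 0 := pow_ne_zero _ (eta_ne (im_half hz))
lemma B_ne {z : ℂ} (hz : 0 < z.im) : B z ≠ 0 := pow_ne_zero _ (eta_ne (im_half' hz))
lemma C_ne {z : ℂ} (hz : 0 < z.im) : C z ≠ 0 :=
  mul_ne_zero (by norm_num) (pow_ne_zero _ (eta_ne (im_two hz)))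
lemma D_ne {z : ℂ} (hz : 0 < z.im) : D z ≠ 0 := pow_ne_zero _ (eta_ne hz)

/- Translation. -/
lemma A_T (z : ℂ) : A (z + 1) = B z := rfl
lemma B_T (z : ℂ) : B (z + 1) = ζ ^ 2 * A z := by
  rw [A, B, ← eta_T8]; congr 2; ring
lemma C_T (z : ℂ) : C (z + 1) = - ζ * C z := by
  rw [C, C, show 2 * (z + 1) = 2 * z + 1 + 1 by ring, eta_T8, eta_T8]
  linear_combination 16 * ζ * ModularForm.eta (2 * z) ^ 8 * ζ3
lemma D_T (z : ℂ) : D (z + 1) = ζ * D z := eta_T4 z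
lemma a_T (z : ℂ) : a (z + 1) = b z := rfl
lemma b_T {z : ℂ} (hz : 0 < z.im) : b (z + 1) = a z := by
  rw [a, b, ← e_T (im_half hz)]; congr 1; ring
lemma c_T {z : ℂ} (hz : 0 < z.im) : c (z + 1) = c z := by
  rw [c, c, show 2 * (z + 1) = 2 * z + 1 + 1 by ring, e_T (im_add (im_two hz)), e_T (im_two hz)]

lemma ne0 {z : ℂ} (hz : 0 < z.im) : z ≠ 0 := by rintro rfl; simp at hz

/- Inversion. -/
lemma A_S {z : ℂ} (hz : 0 < z.im) : A (-1 / z) = z ^ 4 * C z := by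
  have := ne0 hz
  rw [A, C, show -1 / z / 2 = -1 / (2 * z) by field_simp, eta_S8 (im_two hz)]
  ring
lemma C_S {z : ℂ} (hz : 0 < z.im) : C (-1 / z) = z ^ 4 * A z := by
  have := ne0 hz
  rw [A, C, show 2 * (-1 / z) = -1 / (z / 2) by field_simp, eta_S8 (im_half hz)]
  ring
lemma D_S {z : ℂ} (hz : 0 < z.im) : D (-1 / z) = - z ^ 2 * D z := eta_S4 hz
lemma a_S {z : ℂ} (hz : 0 < z.im) : a (-1 / z) = z ^ 2 * c z + 12 * z / (Real.pi * I) := by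
  have := ne0 hz
  rw [a, c, show -1 / z / 2 = -1 / (2 * z) by field_simp, e_S (im_two hz)]
  ring
lemma c_S {z : ℂ} (hz : 0 < z.im) : c (-1 / z) = z ^ 2 * a z + 12 * z / (Real.pi * I) := by
  have := ne0 hz
  rw [a, c, show 2 * (-1 / z) = -1 / (z / 2) by field_simp, e_S (im_half hz)]
  ring

/- The matrix `S T⁻² S T⁻¹` sends `w = (z+1)/2` to `(-1/z+1)/2`. -/
lemma im_u {z : ℂ} (hz : 0 < z.im) : 0 < ((z - 1) / 2).im := im_half (by simpa using hz)
lemma im_v {z : ℂ} (hz : 0 < z.im) : 0 < (-1 / ((z - 1) / 2) - 2).im := by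
  have := S_im (im_u hz)
  simpa using this
lemma move {z : ℂ} (hz : 0 < z.im) : (-1 / z + 1) / 2 = -1 / (-1 / ((z - 1) / 2) - 2) := by
  have h0 := ne0 hz
  have h1 : z - 1 ≠ 0 := by have := ne0 (im_u hz); intro h; simp [h] at this
  have h2 : -1 / ((z - 1) / 2) - 2 = -2 * z / (z - 1) := by field_simp; ring
  rw [h2]
  field_simp
  ring

lemma B_S {z : ℂ} (hz : 0 < z.im) : B (-1 / z) = z ^ 4 * B z := by
  have h1 : z - 1 ≠ 0 := by have := ne0 (im_u hz); intro h; simp [h] at this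
  rw [B, move hz, eta_S8 (im_v hz)]
  have e1 := eta_T8 (-1 / ((z - 1) / 2) - 2)
  have e2 := eta_T8 (-1 / ((z - 1) / 2) - 2 + 1)
  rw [show -1 / ((z - 1) / 2) - 2 + 1 + 1 = -1 / ((z - 1) / 2) by ring, e1, eta_S8 (im_u hz)] at e2
  have e3 := eta_T8 ((z - 1) / 2)
  rw [show (z - 1) / 2 + 1 = (z + 1) / 2 by ring] at e3
  rw [B, e3]
  have h2 : -1 / ((z - 1) / 2) - 2 = -2 * z / (z - 1) := by field_simp; ring
  have h6 : ζ ^ 6 = 1 := by linear_combination (ζ ^ 3 - 1) * ζ3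
  have h7 : (-1 / ((z - 1) / 2) - 2) ^ 4 * ((z - 1) / 2) ^ 4 = z ^ 4 := by
    rw [h2]; field_simp
  have hζ := ζ_ne
  refine mul_left_cancel₀ (pow_ne_zero 4 hζ) ?_
  generalize ModularForm.eta (-1 / ((z - 1) / 2) - 2) = X at *
  generalize ModularForm.eta ((z - 1) / 2) = Y at *
  linear_combination -(-1 / ((z - 1) / 2) - 2) ^ 4 * e2 + Y ^ 8 * h7 - z ^ 4 * Y ^ 8 * h6

lemma b_S {z : ℂ} (hz : 0 < z.im) : b (-1 / z) = z ^ 2 * b z + 12 * z / (Real.pi * I) := by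
  have h1 : z - 1 ≠ 0 := by have := ne0 (im_u hz); intro h; simp [h] at this
  have hp := piI
  rw [b, move hz, e_S (im_v hz)]
  have e1 := e_T (im_v hz)
  have e2 := e_T (im_add (im_v hz))
  rw [show -1 / ((z - 1) / 2) - 2 + 1 + 1 = -1 / ((z - 1) / 2) by ring, e1, e_S (im_u hz)] at e2
  have e3 := e_T (im_u hz)
  rw [show (z - 1) / 2 + 1 = (z + 1) / 2 by ring] at e3
  rw [b, e3, ← e2]
  have h2 : -1 / ((z - 1) / 2) - 2 = -2 * z / (z - 1) := by field_simp; ring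
  rw [h2]
  field_simp
  ring

/- Everything in terms of the nome. -/
lemma a_p {z : ℂ} (hz : 0 < z.im) : a z = E (p z) := by
  rw [a, e_eq (im_half hz), p]; congr 2; ring
lemma p_T (z : ℂ) : p (z + 1) = - p z := by
  rw [p, p, mul_add, Complex.exp_add, mul_one, Complex.exp_pi_mul_I]; ring
lemma b_p {z : ℂ} (hz : 0 < z.im) : b z = E (-p z) := by
  rw [← a_T, a_p (im_add hz), p_T]
lemma c_p {z : ℂ} (hz : 0 < z.im) : c z = 4 * E (p z ^ 4) := by
  rw [c, e_eq (im_two hz), p, ← Complex.exp_nat_mul]; congr 3; push_cast; ring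
lemma A_p (z : ℂ) : A z = cexp (Real.pi * I * z / 3) * F (p z) ^ 8 := by
  rw [A, eta_eq, mul_pow, ← Complex.exp_nat_mul, p]
  congr 2
  · push_cast; ring
  · congr 2; ring
lemma B_p (z : ℂ) : B z = ζ * cexp (Real.pi * I * z / 3) * F (-p z) ^ 8 := by
  rw [← A_T, A_p, p_T, ζ, ← Complex.exp_add]
  congr 2; ring
lemma C_p (z : ℂ) : C z = 16 * (cexp (Real.pi * I * z / 3) * p z) * F (p z ^ 4) ^ 8 := by
  rw [C, eta_eq, mul_pow, ← Complex.exp_nat_mul, p, ← Complex.exp_nat_mul, ← Complex.exp_add]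
  have h1 : ((8 : ℕ) : ℂ) * (Real.pi * I * (2 * z) / 12) = Real.pi * I * z / 3 + Real.pi * I * z := by
    push_cast; ring
  have h2 : 2 * Real.pi * I * (2 * z) = ((4 : ℕ) : ℂ) * (Real.pi * I * z) := by push_cast; ring
  rw [h1, h2, ← mul_assoc (16 : ℂ)]
lemma D_p (z : ℂ) : D z = cexp (Real.pi * I * z / 3) * F (p z ^ 2) ^ 4 := by
  rw [D, eta_eq, mul_pow, ← Complex.exp_nat_mul, p, ← Complex.exp_nat_mul]
  congr 2
  · push_cast; ring
  · congr 2; push_cast; ring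

lemma p_ne (z : ℂ) : p z ≠ 0 := Complex.exp_ne_zero _

lemma R1 {z : ℂ} (hz : 0 < z.im) : r1 (p z) = D z * (c z - b z) / A z := by
  rw [r1, D_p, A_p, c_p hz, b_p hz]
  have := Complex.exp_ne_zero (Real.pi * I * z / 3)
  have := F_ne (p_mem hz)
  field_simp

lemma R3 {z : ℂ} (hz : 0 < z.im) : r1 (-p z) = ζ * D z * (c z - a z) / B z := by
  rw [← p_T, R1 (im_add hz), D_T, c_T hz, b_T hz, A_T]

lemma R2 {z : ℂ} (hz : 0 < z.im) : r2 (p z) = D z * (b z - a z) / C z := by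
  rw [r2, D_p, C_p, a_p hz, b_p hz, E, E]
  have := Complex.exp_ne_zero (Real.pi * I * z / 3)
  have := p_ne z
  have := F_ne (ball_pow (p_mem hz) 4 (by simp))
  field_simp
  ring

lemma cubic (t : ℂ) {z : ℂ} (hz : 0 < z.im) :
    (r1 (p z) - t) * (r2 (p z) - t) * (r1 (-p z) - t) = (3 - t) ^ 3 := by
  refine const_of_inv (fun z => (r1 (p z) - t) * (r2 (p z) - t) * (r1 (-p z) - t)) _
    ?_ ?_ ?_ ?_ z hz
  · intro z hz
    exact ((((r1_diff (p_mem hz)).comp z (p_diff z)).sub_const t).mul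
      (((r2_diff (p_mem hz)).comp z (p_diff z)).sub_const t)).mul
      ((DifferentiableAt.comp (g := fun p => r1 (-p)) z (r1neg_diff (p_mem hz)) (p_diff z)).sub_const t)
  · intro z hz
    have h1 : r1 (p (-1 / z)) = r2 (p z) := by
      rw [R1 (S_im hz), R2 hz, D_S hz, c_S hz, b_S hz, A_S hz]
      have := C_ne hz
      have := ne0 hz
      field_simp
      ring
    have h2 : r2 (p (-1 / z)) = r1 (p z) := by
      rw [R2 (S_im hz), R1 hz, D_S hz, a_S hz, b_S hz, C_S hz]
      have := A_ne hz
      have := ne0 hz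
      field_simp
      ring
    have h3 : r1 (- p (-1 / z)) = r1 (- p z) := by
      rw [R3 (S_im hz), R3 hz, D_S hz, a_S hz, c_S hz, B_S hz]
      have := B_ne hz
      have := ne0 hz
      field_simp
      ring
    simp only [h1, h2, h3]
    ring
  · intro z hz
    have h2 : r2 (p (z + 1)) = r2 (p z) := by
      rw [R2 (im_add hz), R2 hz, D_T, a_T, b_T hz, C_T]
      have := C_ne hz
      have := ζ_ne
      field_simp
      ring
    simp only [h2]
    simp only [p_T, neg_neg]
    ring
  · have h0 : (0 : ℂ) ∈ Metric.ball (0 : ℂ) 1 := by simp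
    have := ((((tendsto_p (r1_diff h0)).sub_const t).mul
      ((tendsto_p (r2_diff h0)).sub_const t)).mul
      ((tendsto_p (r1neg_diff h0)).sub_const t))
    simp only [neg_zero, r1_zero, r2_zero] at this
    convert this using 2
    ring

lemma eqA {z : ℂ} (hz : 0 < z.im) : 3 * A z = D z * (c z - b z) := by
  have h := cubic (r1 (p z)) hz
  rw [sub_self, zero_mul, zero_mul] at h
  have h := pow_eq_zero_iff (by simp) |>.1 h.symm
  have hA := A_ne hz
  rw [R1 hz] at h
  field_simp at h
  linear_combination h

lemma eqB {z : ℂ} (hz : 0 < z.im) : 3 * B z = ζ * D z * (c z - a z) := by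
  have := eqA (im_add hz)
  rwa [A_T, D_T, c_T hz, b_T hz] at this

lemma eqC {z : ℂ} (hz : 0 < z.im) : 3 * C z = D z * (b z - a z) := by
  have := eqA (S_im hz)
  rw [A_S hz, D_S hz, c_S hz, b_S hz] at this
  refine mul_left_cancel₀ (pow_ne_zero 4 (ne0 hz)) ?_
  linear_combination this

lemma prodABC {z : ℂ} (hz : 0 < z.im) : A z * B z * C z = 16 * ζ * D z ^ 6 := by
  have key : A z * B z * C z / D z ^ 6 = 16 * ζ := by
    refine const_of_inv (fun z => A z * B z * C z / D z ^ 6) _ ?_ ?_ ?_ ?_ z hz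
    · intro z hz
      have h1 : DifferentiableAt ℂ A z :=
        (DifferentiableAt.comp z (eta_diff (im_half hz)) (by fun_prop)).pow 8
      have h2 : DifferentiableAt ℂ B z :=
        (DifferentiableAt.comp (f := fun z : ℂ => (z + 1) / 2) z (eta_diff (im_half' hz)) (by fun_prop)).pow 8
      have h3 : DifferentiableAt ℂ C z :=
        ((DifferentiableAt.comp z (eta_diff (im_two hz)) (by fun_prop)).pow 8).const_mul 16
      have h4 : DifferentiableAt ℂ D z := (eta_diff hz).pow 4
      exact ((h1.mul h2).mul h3).div (h4.pow 6) (pow_ne_zero _ (D_ne hz))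
    · intro z hz
      simp only [A_S hz, B_S hz, C_S hz, D_S hz]
      have := D_ne hz
      have := ne0 hz
      field_simp
    · intro z hz
      simp only [A_T, B_T, C_T, D_T]
      have := D_ne hz
      have := ζ_ne
      field_simp
      linear_combination -A z * B z * C z * ζ3
    · have h0 : (0 : ℂ) ∈ Metric.ball (0 : ℂ) 1 := by simp
      have := tendsto_p (((((dAt F_diff h0).pow 8).mul ((dNeg F_diff h0).pow 8)).mul
        ((dPow F_diff h0 4 (by simp)).pow 8)).mul_const (16 * ζ) |>.div
          ((dPow F_diff h0 2 (by simp)).pow 24) (pow_ne_zero _ (F_ne (by simp))))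
      simp [F_zero] at this
      refine this.congr fun z => ?_
      rw [A_p, B_p, C_p, D_p]
      have h1 := Complex.exp_ne_zero (Real.pi * I * z / 3)
      have h3 : p z = cexp (Real.pi * I * z / 3) ^ 3 := by
        rw [p, ← Complex.exp_nat_mul]; congr 1; push_cast; ring
      have h2 := F_ne (ball_pow (p_mem z.2) 2 (by simp))
      generalize cexp (Real.pi * I * z / 3) = x at *
      have h4 : A z * B z = A z * B z := rfl
      generalize F (p z ^ 2) = f2 at *
      generalize F (p z ^ 4) = f4 at *
      generalize F (p z) = f1 at *
      generalize F (-p z) = f5 at *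
      rw [h3]
      field_simp
  have := D_ne hz
  field_simp at key
  linear_combination key

lemma A_deriv {z : ℂ} (hz : 0 < z.im) : HasDerivAt A (Real.pi * I / 3 * a z * A z) z := by
  have h1 : HasDerivAt (fun w : ℂ => w / 2) (1 / 2) z := (hasDerivAt_id z).div_const 2
  have h2 : A = (ModularForm.eta ∘ fun w : ℂ => w / 2) ^ 8 := by
    ext w; simp only [A, Pi.pow_apply, Function.comp]
  have h3 := ((eta_hasDeriv (im_half hz)).comp z h1).pow 8
  rw [← h2] at h3
  refine h3.congr_deriv ?_
  simp only [A, a, Function.comp]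
  push_cast
  ring

lemma B_deriv {z : ℂ} (hz : 0 < z.im) : HasDerivAt B (Real.pi * I / 3 * b z * B z) z := by
  have h1 : HasDerivAt (fun w : ℂ => w + 1) 1 z := (hasDerivAt_id z).add_const 1
  refine ((A_deriv (im_add hz)).comp z h1).congr_deriv ?_
  simp [A_T, a_T]

lemma C_deriv {z : ℂ} (hz : 0 < z.im) : HasDerivAt C (Real.pi * I / 3 * c z * C z) z := by
  have h1 : HasDerivAt (fun w : ℂ => 2 * w) 2 z := by
    simpa using (hasDerivAt_id z).const_mul (2 : ℂ)
  refine ((((eta_hasDeriv (im_two hz)).comp z h1).pow 8).const_mul 16).congr_deriv ?_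
  simp [C, c]
  ring

lemma D_deriv {z : ℂ} (hz : 0 < z.im) : HasDerivAt D (Real.pi * I / 3 * e z * D z) z := by
  refine ((eta_hasDeriv hz).pow 4).congr_deriv ?_
  simp [D]
  ring

lemma hecke {z : ℂ} (hz : 0 < z.im) : a z + b z + c z = 6 * e z := by
  have h1 := ((A_deriv hz).mul (B_deriv hz)).mul (C_deriv hz)
  have h2 := ((D_deriv hz).pow 6).const_mul (16 * ζ)
  have h3 : A * B * C =ᶠ[𝓝 z] fun y => 16 * ζ * (D ^ 6) y := by
    filter_upwards [isOpen_upperHalfPlaneSet.mem_nhds hz] with w hw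
    simpa using prodABC hw
  have h4 := h1.unique (h2.congr_of_eventuallyEq h3)
  have h5 := prodABC hz
  simp at h4
  have h6 := mul_ne_zero (mul_ne_zero (A_ne hz) (B_ne hz)) (C_ne hz)
  have h7 := piI
  refine mul_left_cancel₀ (mul_ne_zero h7 h6) ?_
  linear_combination 3 * h4 - 6 * Real.pi * I * e z * h5

lemma lam_eq (z : ℂ) : modularLambda z = A z * C z ^ 2 / (16 * D z ^ 6) := by
  simp only [modularLambda, ded_eq, A, C, D]
  rw [show ((ModularForm.eta z) ^ 4) ^ 6 = ModularForm.eta z ^ 24 by ring]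
  ring

lemma lam_deriv {z : ℂ} (hz : 0 < z.im) :
    HasDerivAt modularLambda (Real.pi * I * A z / D z * modularLambda z) z := by
  have h0 : modularLambda = fun z => (A * C ^ 2) z / (16 * (D ^ 6) z) := by
    ext z; simp [lam_eq]
  have hD := D_ne hz
  rw [h0]
  refine (((A_deriv hz).mul ((C_deriv hz).pow 2)).div (((D_deriv hz).pow 6).const_mul 16)
    (by simpa using hD)).congr_deriv ?_
  have h1 := eqA hz
  have h2 := hecke hz
  have h3 : A z = D z * (c z - b z) / 3 := by linear_combination h1 / 3
  have h4 : b z = 6 * e z - a z - c z := by linear_combination h2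
  simp
  rw [h4] at h3
  have h5 : A z / D z = (c z - (6 * e z - a z - c z)) / 3 := by rw [h3]; field_simp
  rw [mul_div_assoc (_ * I) (A z), h5]
  generalize A z = x
  field_simp
  ring

end LamProof

open LamProof in
theorem deriv_lambda_eta_over_lambda' (z : ℂ) (hz : 0 < z.im) :
    deriv (fun w : ℂ => modularLambda w * dedekindEta w ^ 4 / deriv modularLambda w) z =
      dedekindEta z ^ 4 * (1 + modularLambda z) / (3 * (1 - modularLambda z)) := by
  have hA := A_ne hz
  have hB := B_ne hz
  have hC := C_ne hz
  have hD := D_ne hz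
  have hp := piI
  have hζ := ζ_ne
  have hev : (fun w : ℂ => modularLambda w * dedekindEta w ^ 4 / deriv modularLambda w)
      =ᶠ[nhds z] fun w => (D ^ 2) w / (Real.pi * I * A w) := by
    filter_upwards [UpperHalfPlane.isOpen_upperHalfPlaneSet.mem_nhds hz] with w hw
    have hA := A_ne hw
    have hC := C_ne hw
    have hD := D_ne hw
    have hl : modularLambda w ≠ 0 := by
      rw [lam_eq]
      exact div_ne_zero (mul_ne_zero hA (pow_ne_zero _ hC)) (mul_ne_zero (by norm_num) (pow_ne_zero _ hD))
    rw [(lam_deriv hw).deriv, ded_eq, ← D, Pi.pow_apply]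
    field_simp
  have hd := (((D_deriv hz).pow 2).div ((A_deriv hz).const_mul (Real.pi * I)) (mul_ne_zero hp hA))
  rw [hev.deriv_eq, show (fun w => (D ^ 2) w / (Real.pi * I * A w)) =
    (D ^ 2) / (fun w => Real.pi * I * A w) from rfl, hd.deriv]
  have h1 := eqA hz
  have h2 := eqB hz
  have h3 := eqC hz
  have h4 := hecke hz
  have h5 := prodABC hz
  have hl : modularLambda z = ζ * C z / B z := by
    rw [lam_eq]
    field_simp
    linear_combination h5
  have hm : B z - ζ * C z = ζ * A z := by
    linear_combination (h2 - ζ * h3 - ζ * h1) / 3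
  have hq : B z + ζ * C z = ζ * D z * (2 * e z - a z) := by
    linear_combination (h2 + ζ * h3 + ζ * D z * h4) / 3
  have hr : (1 + modularLambda z) / (3 * (1 - modularLambda z)) = D z * (2 * e z - a z) / (3 * A z) := by
    have e1 : 1 + modularLambda z = ζ * D z * (2 * e z - a z) / B z := by
      rw [← hq, hl]; field_simp
    have e2 : 1 - modularLambda z = ζ * A z / B z := by
      rw [← hm, hl]; field_simp
    rw [e1, e2]
    field_simp
  rw [mul_div_assoc (_ ^ 4), hr, ded_eq, ← D]
  simp
  field_simp
end

section
/- If f: ℍ → ℂ is holomorphic and Γ(2)-invariant under the weight-0 slash action, and h is a weight-2 form with f transforming as f|₂(γ−1) = d_γ·η⁴ for constants d_γ (γ ∈ Γ(2)), then the function ((λ/λ')·f)' satisfies ((λ/λ')·f)'|₂(γ−1) = ((d_γ·λ·η⁴)/λ')' for every γ ∈ Γ(2). In particular, if f₂ satisfies f₂|₂(γ−1) = d_γ·η⁴ on Γ(2), then ((λ f₂/λ')·)'|₂(γ−1) = (d_γ λη⁴/λ')'. -/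
open Complex

/-- The Möbius action of an element of `SL(2, ℤ)` on `ℂ`. -/
noncomputable def moeb (γ : Matrix.SpecialLinearGroup (Fin 2) ℤ) (z : ℂ) : ℂ :=
  ((γ.1 0 0 : ℂ) * z + (γ.1 0 1 : ℂ)) / ((γ.1 1 0 : ℂ) * z + (γ.1 1 1 : ℂ))

namespace LamAux

lemma dEta_eq : dedekindEta = ModularForm.eta := by
  funext z
  unfold dedekindEta ModularForm.eta
  simp_rw [ModularForm.eta_q_eq_cexp]
  congr 1
  simp only [Function.Periodic.qParam]
  congr 1
  push_cast
  ring

/-- Euler product -/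
noncomputable def Eul (q : ℂ) : ℂ := ∏' n : ℕ, (1 - q ^ (n + 1))
noncomputable def Odd' (q : ℂ) : ℂ := ∏' n : ℕ, (1 - q ^ (2 * n + 1))

lemma dEta_Eul (z : ℂ) :
    dedekindEta z = exp (Real.pi * I * z / 12) * Eul (exp (2 * Real.pi * I * z)) := by
  unfold dedekindEta Eul
  congr 1
  refine tprod_congr fun n => ?_
  rw [← Complex.exp_nat_mul]
  congr 2
  push_cast
  ring

lemma mult_odd {q : ℂ} (hq : ‖q‖ < 1) : Multipliable fun n : ℕ => 1 - q ^ (2 * n + 1) := by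
  have h : Summable fun n : ℕ => ‖q‖ ^ (2 * n + 1) := by
    have := summable_geometric_of_lt_one (norm_nonneg _) hq
    exact this.comp_injective (i := fun n : ℕ => 2 * n + 1) (fun a b h => by simpa using h)
  simp_rw [sub_eq_add_neg]
  apply multipliable_one_add_of_summable (f := fun n : ℕ ↦ -q ^ (2 * n + 1))
  simpa using h

lemma Eul_split {q : ℂ} (hq : ‖q‖ < 1) : Eul q = Odd' q * Eul (q ^ 2) := by
  have hq2 : ‖q ^ 2‖ < 1 := by
    rw [norm_pow]; exact pow_lt_one₀ (norm_nonneg _) hq two_ne_zero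
  have h1 := mult_odd hq
  have h2 := ModularForm.multipliable_one_sub_pow hq2
  have := tprod_even_mul_odd (f := fun n : ℕ => 1 - q ^ (n + 1)) h1 (by
    refine h2.congr fun n => ?_
    rw [← pow_mul]; ring_nf)
  unfold Eul Odd'
  rw [← this]
  congr 1
  refine tprod_congr fun n => ?_
  rw [← pow_mul]; ring_nf

lemma Odd_mul {q : ℂ} (hq : ‖q‖ < 1) : Odd' q * Odd' (-q) = Odd' (q ^ 2) := by
  unfold Odd'
  rw [← (mult_odd hq).tprod_mul (mult_odd (by simpa using hq))]
  refine tprod_congr fun n => ?_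
  rw [Odd.neg_pow ⟨n, rfl⟩ q]
  ring

lemma Eul_prod {q : ℂ} (hq : ‖q‖ < 1) :
    Eul q * Eul (-q) * Eul ((q ^ 2) ^ 2) = Eul (q ^ 2) ^ 3 := by
  have hq2 : ‖q ^ 2‖ < 1 := by
    rw [norm_pow]; exact pow_lt_one₀ (norm_nonneg _) hq two_ne_zero
  have h3 := Eul_split hq2
  have h2 := Eul_split (q := -q) (by simpa using hq)
  rw [neg_sq] at h2
  calc _ = (Odd' q * Odd' (-q)) * Eul ((q ^ 2) ^ 2) * Eul (q ^ 2) ^ 2 := by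
        rw [Eul_split hq, h2]; ring
    _ = _ := by rw [Odd_mul hq, ← h3]; ring

lemma exp_norm_lt {z : ℂ} (hz : 0 < z.im) {r : ℝ} (hr : 0 < r) :
    ‖exp (r * Real.pi * I * z)‖ < 1 := by
  rw [Complex.norm_exp, Real.exp_lt_one_iff]
  have : (r * Real.pi * I * z : ℂ).re = - (r * Real.pi * z.im) := by simp
  rw [this]
  have := Real.pi_pos
  simp only [Left.neg_neg_iff]; positivity

lemma eta_prod {z : ℂ} (hz : 0 < z.im) :
    dedekindEta (z / 2) * dedekindEta ((z + 1) / 2) * dedekindEta (2 * z) =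
      exp (Real.pi * I / 24) * dedekindEta z ^ 3 := by
  have hq : ‖exp (Real.pi * I * z)‖ < 1 := by
    simpa using exp_norm_lt hz one_pos
  have key := Eul_prod hq
  simp only [dEta_Eul]
  have e1 : exp (2 * Real.pi * I * (z / 2)) = exp (Real.pi * I * z) := by congr 1; ring
  have e2 : exp (2 * Real.pi * I * ((z + 1) / 2)) = - exp (Real.pi * I * z) := by
    rw [show 2 * Real.pi * I * ((z + 1) / 2) = Real.pi * I * z + Real.pi * I by ring, exp_add,
      exp_pi_mul_I]; ring
  have e3 : exp (2 * Real.pi * I * z) = exp (Real.pi * I * z) ^ 2 := by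
    rw [← exp_nat_mul]; congr 1; push_cast; ring
  have e4 : exp (2 * Real.pi * I * (2 * z)) = (exp (Real.pi * I * z) ^ 2) ^ 2 := by
    rw [← exp_nat_mul, ← exp_nat_mul]; congr 1; push_cast; ring
  rw [e1, e2, e3, e4, mul_pow, ← key]
  have : exp (Real.pi * I * (z / 2) / 12) * exp (Real.pi * I * ((z + 1) / 2) / 12) *
      exp (Real.pi * I * (2 * z) / 12) = exp (Real.pi * I / 24) * exp (Real.pi * I * z / 12) ^ 3 := by
    rw [← exp_nat_mul, ← exp_add, ← exp_add, ← exp_add]; congr 1; push_cast; ring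
  linear_combination (Eul (exp (Real.pi * I * z)) * Eul (-exp (Real.pi * I * z)) *
    Eul ((exp (Real.pi * I * z) ^ 2) ^ 2)) * this

lemma eta_ne {z : ℂ} (hz : 0 < z.im) : dedekindEta z ≠ 0 := by
  rw [dEta_eq]; exact ModularForm.eta_ne_zero hz

lemma eta_diff {z : ℂ} (hz : 0 < z.im) : DifferentiableAt ℂ dedekindEta z := by
  rw [dEta_eq]; exact ModularForm.differentiableAt_eta_of_mem_upperHalfPlaneSet hz

noncomputable def ze : ℂ := exp (Real.pi * I / 3)

lemma ze_cube : ze ^ 3 = -1 := by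
  unfold ze
  rw [← exp_nat_mul, show ((3 : ℕ) : ℂ) * (Real.pi * I / 3) = Real.pi * I by push_cast; ring,
    exp_pi_mul_I]

lemma ze_ne : ze ≠ 0 := exp_ne_zero _

lemma eta_T (z : ℂ) : dedekindEta (z + 1) ^ 8 = ze ^ 2 * dedekindEta z ^ 8 := by
  simp only [dEta_Eul]
  have e1 : exp (2 * Real.pi * I * (z + 1)) = exp (2 * Real.pi * I * z) := by
    rw [mul_add, mul_one, exp_add, exp_two_pi_mul_I, mul_one]
  have e2 : exp (Real.pi * I * (z + 1) / 12) ^ 8 = ze ^ 2 * exp (Real.pi * I * z / 12) ^ 8 := by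
    unfold ze
    rw [← exp_nat_mul, ← exp_nat_mul, ← exp_nat_mul, ← exp_add]
    congr 1; push_cast; ring
  rw [e1, mul_pow, mul_pow, e2]; ring

lemma csqrt_8 {z : ℂ} (hz : z ≠ 0) : Complex.sqrt z ^ 8 = z ^ 4 := by
  rw [_root_.sqrt_eq_exp hz, ← exp_nat_mul]
  rw [show ((8 : ℕ) : ℂ) * (log z / 2) = (4 : ℕ) * log z by push_cast; ring, exp_nat_mul, exp_log hz]

lemma eta_S {z : ℂ} (hz : 0 < z.im) : dedekindEta (-1 / z) ^ 8 = z ^ 4 * dedekindEta z ^ 8 := by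
  have h := ModularForm.eta_comp_eq_csqrt_I_inv hz
  have hz0 : z ≠ 0 := by rintro rfl; simp at hz
  simp only [Function.comp, Pi.smul_apply, Pi.mul_apply, smul_eq_mul] at h
  rw [dEta_eq, h, mul_pow, mul_pow, inv_pow, csqrt_8 I_ne_zero, csqrt_8 hz0]
  simp

lemma im_S {z : ℂ} (hz : 0 < z.im) : 0 < (-1 / z).im := by
  rw [neg_div, neg_im, one_div, inv_im]
  have : 0 < normSq z := normSq_pos.2 (by rintro rfl; simp at hz)
  rw [neg_div, neg_neg]; positivity

lemma eta_C_S {z : ℂ} (hz : 0 < z.im) :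
    dedekindEta ((-1 / z + 1) / 2) ^ 8 = z ^ 4 * dedekindEta ((z + 1) / 2) ^ 8 := by
  have hz0 : z ≠ 0 := by rintro rfl; simp at hz
  have hw : 0 < ((z - 1) / 2).im := by simp; linarith
  have hw0 : (z - 1) / 2 ≠ 0 := fun h => by rw [h] at hw; simp at hw
  have hz1 : z - 1 ≠ 0 := fun h => by rw [h] at hw0; simp at hw0
  set u := -2 + -1 / ((z - 1) / 2) with hu
  have hui : 0 < u.im := by
    have := im_S hw
    rw [hu, add_im]; simpa using this
  have e : (-1 / z + 1) / 2 = -1 / u := by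
    have : u = -2 * z / (z - 1) := by rw [hu]; field_simp; ring
    rw [this]; field_simp; ring
  rw [e, eta_S hui]
  have t1 := eta_T u
  have t2 := eta_T (u + 1)
  have t3 := eta_T ((z - 1) / 2)
  rw [show u + 1 + 1 = -1 / ((z - 1) / 2) by rw [hu]; ring, eta_S hw, t1] at t2
  rw [show (z - 1) / 2 + 1 = (z + 1) / 2 by ring] at t3
  have hu2 : u * ((z - 1) / 2) = -z := by rw [hu]; field_simp; ring
  have hz4 : z ^ 4 = u ^ 4 * ((z - 1) / 2) ^ 4 := by rw [← mul_pow, hu2]; ring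
  rw [hz4, t3]
  have z6 : ze ^ 6 = 1 := by rw [show ze ^ 6 = (ze ^ 3) ^ 2 by ring, ze_cube]; ring
  linear_combination (-u ^ 4 * ze ^ 2) * t2 - u ^ 4 * dedekindEta u ^ 8 * z6

noncomputable def X (z : ℂ) : ℂ := dedekindEta (z / 2) ^ 8
noncomputable def Y (z : ℂ) : ℂ := 16 * dedekindEta (2 * z) ^ 8
noncomputable def Z (z : ℂ) : ℂ := - (ze⁻¹ * dedekindEta ((z + 1) / 2) ^ 8)

lemma im1 {z : ℂ} (hz : 0 < z.im) : 0 < (z / 2).im := by simp; linarith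
lemma im2 {z : ℂ} (hz : 0 < z.im) : 0 < (2 * z).im := by simp; linarith
lemma im3 {z : ℂ} (hz : 0 < z.im) : 0 < ((z + 1) / 2).im := by simp; linarith

lemma X_ne {z : ℂ} (hz : 0 < z.im) : X z ≠ 0 := pow_ne_zero _ (eta_ne (im1 hz))
lemma Y_ne {z : ℂ} (hz : 0 < z.im) : Y z ≠ 0 :=
  mul_ne_zero (by norm_num) (pow_ne_zero _ (eta_ne (im2 hz)))
lemma Z_ne {z : ℂ} (hz : 0 < z.im) : Z z ≠ 0 :=
  neg_ne_zero.2 (mul_ne_zero (inv_ne_zero ze_ne) (pow_ne_zero _ (eta_ne (im3 hz))))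

lemma lam_eq {z : ℂ} (hz : 0 < z.im) : modularLambda z = - Y z / Z z := by
  have h := congrArg (· ^ 8) (eta_prod hz)
  simp only [mul_pow] at h
  have : exp (Real.pi * I / 24) ^ 8 = ze := by
    unfold ze; rw [← exp_nat_mul]; congr 1; push_cast; ring
  rw [this] at h
  unfold modularLambda
  have hZ := Z_ne hz
  rw [div_eq_div_iff (pow_ne_zero _ (eta_ne hz)) hZ]
  unfold Y Z
  have := ze_ne
  generalize dedekindEta (2 * z) = b at *
  generalize dedekindEta (z / 2) = a at *
  generalize dedekindEta ((z + 1) / 2) = c at *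
  have h2 : ze * ze⁻¹ = 1 := mul_inv_cancel₀ this
  linear_combination (-16) * ze⁻¹ * b ^ 8 * h - 16 * b ^ 8 * dedekindEta z ^ 24 * h2

lemma X_S {z : ℂ} (hz : 0 < z.im) : X (-1 / z) = z ^ 4 * Y z := by
  unfold X Y
  rw [show -1 / z / 2 = -1 / (2 * z) by rw [div_div, mul_comm], eta_S (im2 hz)]; ring
lemma Y_S {z : ℂ} (hz : 0 < z.im) : Y (-1 / z) = z ^ 4 * X z := by
  have hz0 : z ≠ 0 := by rintro rfl; simp at hz
  unfold X Y
  rw [show 2 * (-1 / z) = -1 / (z / 2) by field_simp, eta_S (im1 hz)]; ring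
lemma Z_S {z : ℂ} (hz : 0 < z.im) : Z (-1 / z) = z ^ 4 * Z z := by
  unfold Z; rw [eta_C_S hz]; ring
lemma X_T (z : ℂ) : X (z + 1) = -ze * Z z := by
  have := ze_ne
  unfold X Z; field_simp
lemma Y_T (z : ℂ) : Y (z + 1) = -ze * Y z := by
  unfold Y
  rw [show 2 * (z + 1) = 2 * z + 1 + 1 by ring, eta_T, eta_T]
  linear_combination 16 * ze * dedekindEta (2 * z) ^ 8 * ze_cube
lemma Z_T (z : ℂ) : Z (z + 1) = -ze * X z := by
  have := ze_ne
  unfold X Z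
  rw [show (z + 1 + 1) / 2 = z / 2 + 1 by ring, eta_T]
  field_simp

/-! action -/
open UpperHalfPlane in
noncomputable def ev (v : Fin 2 → ZMod 2) (z : ℍ) : ℂ :=
  if v = 0 then 0 else if v = ![1, 0] then X z else if v = ![0, 1] then Y z else Z z

noncomputable def red (γ : Matrix.SpecialLinearGroup (Fin 2) ℤ) : Matrix (Fin 2) (Fin 2) (ZMod 2) :=
  (γ.1).map (Int.castRingHom (ZMod 2))

lemma red_mul (γ δ : Matrix.SpecialLinearGroup (Fin 2) ℤ) : red (γ * δ) = red γ * red δ := by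
  unfold red; rw [Matrix.SpecialLinearGroup.coe_mul, Matrix.map_mul]

lemma red_one : red 1 = 1 := by
  unfold red; simp

open UpperHalfPlane in
def RR (γ : Matrix.SpecialLinearGroup (Fin 2) ℤ) : Prop :=
  ∀ z : ℍ, ∃ c : ℂ, c ≠ 0 ∧ ∀ v, ev v (γ • z) = c * ev (Matrix.vecMul v (red γ)) z

lemma v_cases (v : Fin 2 → ZMod 2) : v = 0 ∨ v = ![1, 0] ∨ v = ![0, 1] ∨ v = ![1, 1] := by
  revert v; decide

lemma ev0 (z) : ev 0 z = 0 := by simp [ev]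
lemma ev1 (z) : ev ![1, 0] z = X z := by simp [ev]
lemma ev2 (z) : ev ![0, 1] z = Y z := by simp [ev]
lemma ev3 (z) : ev ![1, 1] z = Z z := by simp [ev]

open UpperHalfPlane in
lemma coe_S (z : ℍ) : ((ModularGroup.S • z : ℍ) : ℂ) = -1 / (z : ℂ) := by
  rw [modular_S_smul]; simp [neg_div, inv_neg]
open UpperHalfPlane in
lemma coe_T (z : ℍ) : ((ModularGroup.T • z : ℍ) : ℂ) = (z : ℂ) + 1 := by
  rw [modular_T_smul]; simp [add_comm]

lemma RR_S : RR ModularGroup.S := by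
  intro z
  have hz : 0 < (z : ℂ).im := z.im_pos
  refine ⟨(z : ℂ) ^ 4, pow_ne_zero _ z.ne_zero, fun v => ?_⟩
  have m : ∀ v, Matrix.vecMul v (red ModularGroup.S) = ![v 1, v 0] := by
    unfold red ModularGroup.S; decide
  rw [m]
  rcases v_cases v with rfl | rfl | rfl | rfl
  · have : ![(0 : Fin 2 → ZMod 2) 1, (0 : Fin 2 → ZMod 2) 0] = 0 := by decide
    rw [this, ev0, ev0, mul_zero]
  · simp only [Matrix.cons_val_zero, Matrix.cons_val_one]
    rw [ev1, ev2, coe_S, X_S hz]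
  · simp only [Matrix.cons_val_zero, Matrix.cons_val_one]
    rw [ev1, ev2, coe_S, Y_S hz]
  · simp only [Matrix.cons_val_zero, Matrix.cons_val_one]
    rw [ev3, ev3, coe_S, Z_S hz]

lemma RR_T : RR ModularGroup.T := by
  intro z
  refine ⟨-ze, neg_ne_zero.2 ze_ne, fun v => ?_⟩
  have m : ∀ v, Matrix.vecMul v (red ModularGroup.T) = ![v 0, v 0 + v 1] := by
    unfold red ModularGroup.T; decide
  rw [m]
  rcases v_cases v with rfl | rfl | rfl | rfl
  · have : ![(0 : Fin 2 → ZMod 2) 0, (0 : Fin 2 → ZMod 2) 0 + (0 : Fin 2 → ZMod 2) 1] = 0 := by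
      decide
    rw [this, ev0, ev0, mul_zero]
  · have : ![(![1, 0] : Fin 2 → ZMod 2) 0, (![1, 0] : Fin 2 → ZMod 2) 0 +
      (![1, 0] : Fin 2 → ZMod 2) 1] = ![1, 1] := by decide
    rw [this, ev1, ev3, coe_T, X_T]
  · have : ![(![0, 1] : Fin 2 → ZMod 2) 0, (![0, 1] : Fin 2 → ZMod 2) 0 +
      (![0, 1] : Fin 2 → ZMod 2) 1] = ![0, 1] := by decide
    rw [this, ev2, ev2, coe_T, Y_T]
  · have : ![(![1, 1] : Fin 2 → ZMod 2) 0, (![1, 1] : Fin 2 → ZMod 2) 0 +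
      (![1, 1] : Fin 2 → ZMod 2) 1] = ![1, 0] := by decide
    rw [this, ev3, ev1, coe_T, Z_T]

lemma RR_all (γ : Matrix.SpecialLinearGroup (Fin 2) ℤ) : RR γ := by
  have : γ ∈ Subgroup.closure {ModularGroup.S, ModularGroup.T} := by
    simp [_root_.SpecialLinearGroup.SL2Z_generators]
  induction this using Subgroup.closure_induction with
  | one => exact fun z => ⟨1, one_ne_zero, fun v => by rw [red_one]; simp⟩
  | mem g hg =>
    rcases hg with h | h
    · rw [h]; exact RR_S
    · rw [h]; exact RR_T
  | mul g h _ _ ig ih =>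
    intro z
    obtain ⟨c, hc, h1⟩ := ig (h • z)
    obtain ⟨c', hc', h2⟩ := ih z
    refine ⟨c * c', mul_ne_zero hc hc', fun v => ?_⟩
    rw [mul_smul, h1, h2, red_mul, Matrix.vecMul_vecMul, mul_assoc]
  | inv g _ ig =>
    intro z
    obtain ⟨c, hc, h1⟩ := ig (g⁻¹ • z)
    refine ⟨c⁻¹, inv_ne_zero hc, fun v => ?_⟩
    have := h1 (Matrix.vecMul v (red g⁻¹))
    rw [smul_inv_smul, Matrix.vecMul_vecMul, ← red_mul, inv_mul_cancel, red_one,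
      Matrix.vecMul_one] at this
    rw [this, inv_mul_cancel_left₀ hc]

lemma moeb_eq (γ : Matrix.SpecialLinearGroup (Fin 2) ℤ) (z : UpperHalfPlane) :
    moeb γ z = ((γ • z : UpperHalfPlane) : ℂ) := by
  rw [UpperHalfPlane.coe_specialLinearGroup_apply]; simp [moeb]

lemma moeb_im (γ : Matrix.SpecialLinearGroup (Fin 2) ℤ) {z : ℂ} (hz : 0 < z.im) :
    0 < (moeb γ z).im := by
  have := moeb_eq γ ⟨z, hz⟩
  simp only at this
  rw [this]; exact (γ • (⟨z, hz⟩ : UpperHalfPlane)).im_pos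

lemma lam_inv {γ : Matrix.SpecialLinearGroup (Fin 2) ℤ} (hγ : γ ∈ CongruenceSubgroup.Gamma 2)
    {z : ℂ} (hz : 0 < z.im) : modularLambda (moeb γ z) = modularLambda z := by
  obtain ⟨c, hc, h⟩ := RR_all γ ⟨z, hz⟩
  have hr : red γ = 1 := by
    rw [CongruenceSubgroup.Gamma_mem] at hγ
    obtain ⟨h1, h2, h3, h4⟩ := hγ
    unfold red
    ext i j
    fin_cases i <;> fin_cases j <;> simp_all
  have h2 := h ![0, 1]
  have h3 := h ![1, 1]
  rw [hr, Matrix.vecMul_one, ev2, ev2, ← moeb_eq] at h2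
  rw [hr, Matrix.vecMul_one, ev3, ev3, ← moeb_eq] at h3
  rw [lam_eq hz, lam_eq (moeb_im γ hz)]
  simp only at h2 h3
  rw [h2, h3]
  have := Z_ne hz
  field_simp

/-! log derivatives -/
open Filter Topology

lemma H_nhds {z : ℂ} (hz : 0 < z.im) : ∀ᶠ w in 𝓝 z, 0 < w.im :=
  (isOpen_lt continuous_const Complex.continuous_im).mem_nhds hz

lemma ld_congr {f g : ℂ → ℂ} {z : ℂ} (h : f =ᶠ[𝓝 z] g) : logDeriv f z = logDeriv g z :=
  (logDeriv_congr_nhds h).eq_of_nhds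

lemma X_diff {z : ℂ} (hz : 0 < z.im) : DifferentiableAt ℂ X z := by
  unfold X
  exact (DifferentiableAt.comp z (g := dedekindEta) (f := fun z => z / 2)
    (eta_diff (im1 hz)) (by fun_prop)).pow 8
lemma Y_diff {z : ℂ} (hz : 0 < z.im) : DifferentiableAt ℂ Y z := by
  unfold Y
  exact ((DifferentiableAt.comp z (g := dedekindEta) (f := fun z => 2 * z)
    (eta_diff (im2 hz)) (by fun_prop)).pow 8).const_mul 16
lemma Z_diff {z : ℂ} (hz : 0 < z.im) : DifferentiableAt ℂ Z z := by
  unfold Z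
  exact (((DifferentiableAt.comp z (g := dedekindEta) (f := fun z => (z + 1) / 2)
    (eta_diff (im3 hz)) (by fun_prop)).pow 8).const_mul ze⁻¹).neg

lemma ld_S {F G : ℂ → ℂ} (hF : ∀ z : ℂ, 0 < z.im → DifferentiableAt ℂ F z)
    (hG : ∀ z : ℂ, 0 < z.im → DifferentiableAt ℂ G z) (hG0 : ∀ z : ℂ, 0 < z.im → G z ≠ 0)
    (h : ∀ z : ℂ, 0 < z.im → F (-1 / z) = z ^ 4 * G z) {z : ℂ} (hz : 0 < z.im) :
    logDeriv F (-1 / z) * (z ^ 2)⁻¹ = 4 / z + logDeriv G z := by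
  have hz0 : z ≠ 0 := by rintro rfl; simp at hz
  have hd : HasDerivAt (fun w : ℂ => -1 / w) ((z ^ 2)⁻¹) z := by
    have h := (hasDerivAt_inv hz0).fun_neg
    have e0 : (fun w : ℂ => -1 / w) = fun w => -w⁻¹ := by funext w; simp [neg_div]
    rw [e0]; simpa using h
  have e : F ∘ (fun w : ℂ => -1 / w) =ᶠ[𝓝 z] fun w => w ^ 4 * G w := by
    filter_upwards [H_nhds hz] with w hw using h w hw
  have := ld_congr e
  rw [logDeriv_comp (hF _ (im_S hz)) hd.differentiableAt, hd.deriv,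
    logDeriv_mul (f := fun w : ℂ => w ^ 4) z (pow_ne_zero _ hz0) (hG0 z hz) (by fun_prop) (hG z hz),
    logDeriv_pow] at this
  simpa using this

lemma ld_T {F G : ℂ → ℂ} (hF : ∀ z : ℂ, 0 < z.im → DifferentiableAt ℂ F z)
    (c : ℂ) (hc : c ≠ 0)
    (h : ∀ z : ℂ, F (z + 1) = c * G z) {z : ℂ} (hz : 0 < z.im) :
    logDeriv F (z + 1) = logDeriv G z := by
  have e : F ∘ (fun w : ℂ => w + 1) = fun w => c * G w := funext h
  have hd : HasDerivAt (fun w : ℂ => w + 1) 1 z := (hasDerivAt_id z).add_const 1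
  have := congrFun (congrArg logDeriv e) z
  rw [logDeriv_comp (hF _ (by simpa using hz)) hd.differentiableAt, hd.deriv,
    logDeriv_const_mul z c hc] at this
  simpa using this

noncomputable def PC (z : ℂ) : ℂ :=
  ((logDeriv X z - logDeriv Y z) * (logDeriv Y z - logDeriv Z z) *
    (logDeriv Z z - logDeriv X z)) ^ 2

lemma PC_S {z : ℂ} (hz : 0 < z.im) : PC (-1 / z) * (z ^ 12)⁻¹ = PC z := by
  have h1 := ld_S (fun _ => X_diff) (fun _ => Y_diff) (fun _ => Y_ne) (fun _ => X_S) hz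
  have h2 := ld_S (fun _ => Y_diff) (fun _ => X_diff) (fun _ => X_ne) (fun _ => Y_S) hz
  have h3 := ld_S (fun _ => Z_diff) (fun _ => Z_diff) (fun _ => Z_ne) (fun _ => Z_S) hz
  unfold PC
  have : (z ^ 12)⁻¹ = (((z ^ 2)⁻¹) ^ 3) ^ 2 := by rw [inv_pow, inv_pow]; congr 1; ring
  rw [this]
  rw [← sub_eq_iff_eq_add'] at h1 h2 h3
  rw [← h1, ← h2, ← h3]; ring

lemma PC_T {z : ℂ} (hz : 0 < z.im) : PC (z + 1) = PC z := by
  have h1 := ld_T (fun _ => X_diff) _ (neg_ne_zero.2 ze_ne) X_T hz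
  have h2 := ld_T (fun _ => Y_diff) _ (neg_ne_zero.2 ze_ne) Y_T hz
  have h3 := ld_T (fun _ => Z_diff) _ (neg_ne_zero.2 ze_ne) Z_T hz
  unfold PC
  rw [h1, h2, h3]; ring

lemma ld_diff {F : ℂ → ℂ} (hF : ∀ z : ℂ, 0 < z.im → DifferentiableAt ℂ F z)
    (hF0 : ∀ z : ℂ, 0 < z.im → F z ≠ 0) {z : ℂ} (hz : 0 < z.im) :
    DifferentiableAt ℂ (logDeriv F) z := by
  have hopen : IsOpen {w : ℂ | 0 < w.im} := isOpen_lt continuous_const Complex.continuous_im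
  have h1 : DifferentiableOn ℂ F {w : ℂ | 0 < w.im} := fun w hw => (hF w hw).differentiableWithinAt
  exact ((h1.deriv hopen).differentiableAt (hopen.mem_nhds hz)).div (hF z hz) (hF0 z hz)

lemma PC_diff {z : ℂ} (hz : 0 < z.im) : DifferentiableAt ℂ PC z := by
  have h1 := ld_diff (fun _ => X_diff) (fun _ => X_ne) hz
  have h2 := ld_diff (fun _ => Y_diff) (fun _ => Y_ne) hz
  have h3 := ld_diff (fun _ => Z_diff) (fun _ => Z_ne) hz
  unfold PC
  exact (((h1.sub h2).mul (h2.sub h3)).mul (h3.sub h1)).pow 2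

/-! behaviour at infinity -/

lemma Eul_diffOn : DifferentiableOn ℂ Eul (Metric.ball 0 1) :=
  ModularForm.differentiableOn_tprod_one_sub_pow

lemma Eul_zero : Eul 0 = 1 := by simp [Eul]

lemma Eul_ne {z : ℂ} (hz : 0 < z.im) : Eul (exp (2 * Real.pi * I * z)) ≠ 0 := by
  have := eta_ne hz
  rw [dEta_Eul] at this
  exact right_ne_zero_of_mul this

lemma ldEul_zero : logDeriv Eul 0 = -1 := by
  have t : ∀ n : ℕ, logDeriv (fun q : ℂ => 1 - q ^ (n + 1)) 0 = if n = 0 then -1 else 0 := by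
    intro n
    rw [logDeriv_apply]
    have : HasDerivAt (fun q : ℂ => 1 - q ^ (n + 1)) (-(((n + 1 : ℕ) : ℂ) * 0 ^ n)) 0 := by
      simpa using (hasDerivAt_pow (n + 1) (0 : ℂ)).const_sub 1
    rw [this.deriv]
    rcases n with _ | n <;> simp
  have h := logDeriv_tprod_eq_tsum (f := fun (n : ℕ) (q : ℂ) => 1 - q ^ (n + 1))
    (s := Metric.ball (0 : ℂ) 1) Metric.isOpen_ball (x := 0) (by simp) (by simp)
    (fun i => by fun_prop) (by
      simp_rw [t]
      exact summable_of_ne_finset_zero (s := {0}) (by simp))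
    ModularForm.multipliableLocallyUniformlyOn_one_sub_pow (by simp)
  change logDeriv (fun q => ∏' n : ℕ, (1 - q ^ (n + 1))) 0 = -1
  rw [h]
  simp_rw [t]
  rw [tsum_eq_single 0 (by simp +contextual)]
  simp

lemma ldEul_cont : ContinuousAt (logDeriv Eul) 0 := by
  have h1 : DifferentiableAt ℂ (deriv Eul) 0 :=
    (Eul_diffOn.deriv Metric.isOpen_ball).differentiableAt (Metric.ball_mem_nhds _ one_pos)
  have h2 : DifferentiableAt ℂ Eul 0 := Eul_diffOn.differentiableAt (Metric.ball_mem_nhds _ one_pos)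
  exact (h1.div h2 (by rw [Eul_zero]; exact one_ne_zero)).continuousAt

lemma ld_eta {z : ℂ} (hz : 0 < z.im) : logDeriv dedekindEta z =
    Real.pi * I / 12 + 2 * Real.pi * I * exp (2 * Real.pi * I * z) *
      logDeriv Eul (exp (2 * Real.pi * I * z)) := by
  have hq : ‖exp (2 * Real.pi * I * z)‖ < 1 := by simpa using exp_norm_lt hz two_pos
  have e : dedekindEta = fun z => exp (Real.pi * I * z / 12) * (Eul ∘ fun z => exp (2 * Real.pi * I * z)) z :=
    funext dEta_Eul
  have hE : DifferentiableAt ℂ Eul (exp (2 * Real.pi * I * z)) :=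
    Eul_diffOn.differentiableAt (Metric.isOpen_ball.mem_nhds (by simpa using hq))
  have hd : HasDerivAt (fun z => exp (2 * Real.pi * I * z))
      (exp (2 * Real.pi * I * z) * (2 * Real.pi * I)) z := by
    simpa using ((hasDerivAt_id z).const_mul (2 * Real.pi * I)).cexp
  have hd2 : HasDerivAt (fun z => exp (Real.pi * I * z / 12))
      (exp (Real.pi * I * z / 12) * (Real.pi * I / 12)) z := by
    simpa using (((hasDerivAt_id z).const_mul (Real.pi * I)).div_const 12).cexp
  rw [e, logDeriv_mul (f := fun z => exp (Real.pi * I * z / 12)) z (exp_ne_zero _) (Eul_ne hz) (by fun_prop)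
    (hE.comp z hd.differentiableAt), logDeriv_comp (g := fun z => exp (2 * Real.pi * I * z)) hE hd.differentiableAt, hd.deriv,
    logDeriv_apply, hd2.deriv, mul_div_cancel_left₀ _ (exp_ne_zero _)]
  ring

lemma ld_X {z : ℂ} (hz : 0 < z.im) : logDeriv X z = 4 * logDeriv dedekindEta (z / 2) := by
  have hd : HasDerivAt (fun z : ℂ => z / 2) (1 / 2) z := (hasDerivAt_id z).div_const 2
  have h0 := eta_diff (im1 hz)
  have e : X = fun z => (dedekindEta ∘ fun z => z / 2) z ^ 8 := rfl
  rw [e, logDeriv_fun_pow (h0.comp z hd.differentiableAt),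
    logDeriv_comp (g := fun z : ℂ => z / 2) h0 hd.differentiableAt, hd.deriv]
  push_cast; ring
lemma ld_Y {z : ℂ} (hz : 0 < z.im) : logDeriv Y z = 16 * logDeriv dedekindEta (2 * z) := by
  have hd : HasDerivAt (fun z : ℂ => 2 * z) 2 z := by simpa using (hasDerivAt_id z).const_mul 2
  have h0 := eta_diff (im2 hz)
  have e : Y = fun z => 16 * (fun z => (dedekindEta ∘ fun z => 2 * z) z ^ 8) z := rfl
  rw [e, logDeriv_const_mul z 16 (by norm_num), logDeriv_fun_pow (h0.comp z hd.differentiableAt),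
    logDeriv_comp h0 hd.differentiableAt, hd.deriv]
  push_cast; ring
lemma ld_Z {z : ℂ} (hz : 0 < z.im) : logDeriv Z z = 4 * logDeriv dedekindEta ((z + 1) / 2) := by
  have hd : HasDerivAt (fun z : ℂ => (z + 1) / 2) (1 / 2) z :=
    ((hasDerivAt_id z).add_const 1).div_const 2
  have h0 := eta_diff (im3 hz)
  have e : Z = fun z => (-ze⁻¹) * (fun z => (dedekindEta ∘ fun z => (z + 1) / 2) z ^ 8) z := by
    funext z; simp [Z]
  rw [e, logDeriv_const_mul z _ (neg_ne_zero.2 (inv_ne_zero ze_ne)),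
    logDeriv_fun_pow (h0.comp z hd.differentiableAt),
    logDeriv_comp (g := fun z : ℂ => (z + 1) / 2) h0 hd.differentiableAt, hd.deriv]
  push_cast; ring

noncomputable def RQ (p : ℂ) : ℂ :=
  ((4 * (Real.pi * I / 12 + 2 * Real.pi * I * p * logDeriv Eul p) -
    16 * (Real.pi * I / 12 + 2 * Real.pi * I * p ^ 4 * logDeriv Eul (p ^ 4))) *
  (16 * (Real.pi * I / 12 + 2 * Real.pi * I * p ^ 4 * logDeriv Eul (p ^ 4)) -
    4 * (Real.pi * I / 12 + 2 * Real.pi * I * (-p) * logDeriv Eul (-p))) *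
  (-8 * Real.pi * I * (logDeriv Eul (-p) + logDeriv Eul p))) ^ 2

lemma PC_eq {z : ℂ} (hz : 0 < z.im) :
    PC z = exp (Real.pi * I * z) ^ 2 * RQ (exp (Real.pi * I * z)) := by
  have e1 : exp (2 * Real.pi * I * (z / 2)) = exp (Real.pi * I * z) := by congr 1; ring
  have e2 : exp (2 * Real.pi * I * ((z + 1) / 2)) = - exp (Real.pi * I * z) := by
    rw [show 2 * Real.pi * I * ((z + 1) / 2) = Real.pi * I * z + Real.pi * I by ring, exp_add,
      exp_pi_mul_I]; ring
  have e4 : exp (2 * Real.pi * I * (2 * z)) = exp (Real.pi * I * z) ^ 4 := by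
    rw [← exp_nat_mul]; congr 1; push_cast; ring
  unfold PC RQ
  rw [ld_X hz, ld_Y hz, ld_Z hz, ld_eta (im1 hz), ld_eta (im2 hz), ld_eta (im3 hz), e1, e2, e4]
  ring

lemma RQ_zero : RQ 0 ≠ 0 := by
  unfold RQ
  have : (Real.pi : ℂ) ≠ 0 := by exact_mod_cast Real.pi_ne_zero
  have h0 : (4 * (Real.pi * I / 12) - 16 * (Real.pi * I / 12) : ℂ) = -(Real.pi * I) := by ring
  have h1 : (16 * (Real.pi * I / 12) - 4 * (Real.pi * I / 12) : ℂ) = (Real.pi * I) := by ring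
  simp [ldEul_zero, h0, h1, this]

lemma RQ_cont : ContinuousAt RQ 0 := by
  have h1 := ldEul_cont
  have h2 : ContinuousAt (fun p : ℂ => logDeriv Eul (-p)) 0 :=
    ContinuousAt.comp (g := logDeriv Eul) (f := fun p : ℂ => -p) (by simpa using h1) (by fun_prop)
  have h4 : ContinuousAt (fun p : ℂ => logDeriv Eul (p ^ 4)) 0 :=
    ContinuousAt.comp (g := logDeriv Eul) (f := fun p : ℂ => p ^ 4) (by simpa using h1) (by fun_prop)
  unfold RQ
  fun_prop

open UpperHalfPlane in
lemma p_tendsto : Tendsto (fun z : ℍ => exp (Real.pi * Complex.I * z)) atImInfty (𝓝 0) := by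
  have := qParam_tendsto_atImInfty two_pos
  refine this.congr fun z => ?_
  simp only [Function.Periodic.qParam]
  congr 1; push_cast; ring

open UpperHalfPlane ModularForm MatrixGroups SlashInvariantForm in
lemma PC_slash (γ : SL(2, ℤ)) : (fun z : ℍ => PC z) ∣[(12 : ℤ)] γ = fun z : ℍ => PC z := by
  refine slash_action_generators_SL2Z ?_ ?_ γ
  · ext z
    rw [SL_slash_apply, coe_S, ModularGroup.denom_S]
    exact_mod_cast PC_S z.im_pos
  · ext z
    rw [SL_slash_apply, coe_T, PC_T z.im_pos]
    rw [ModularGroup.denom_apply]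
    simp [ModularGroup.T]

open UpperHalfPlane ModularForm MatrixGroups SlashInvariantForm in
noncomputable def PCusp : CuspForm 𝒮ℒ 12 where
  toFun := fun z : ℍ => PC z
  slash_action_eq' A hA := by
    obtain ⟨A, rfl⟩ := hA
    exact PC_slash A
  holo' := by
    rw [UpperHalfPlane.mdifferentiable_iff]
    refine .congr (fun z hz ↦ (PC_diff hz).differentiableWithinAt) fun z hz ↦ ?_
    simp [ofComplex_apply_of_im_pos hz]
  zero_at_cusps' hc := by
    rw [Subgroup.IsArithmetic.isCusp_iff_isCusp_SL2Z] at hc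
    rw [OnePoint.isZeroAt_iff_forall_SL2Z hc]
    intro γ _
    rw [PC_slash]
    have h : Tendsto (fun z : ℍ => exp (Real.pi * Complex.I * z) ^ 2 * RQ (exp (Real.pi * Complex.I * z)))
      atImInfty (𝓝 (0 ^ 2 * RQ 0)) := (p_tendsto.pow 2).mul (RQ_cont.tendsto.comp p_tendsto)
    rw [zero_pow two_ne_zero, zero_mul] at h
    exact h.congr fun z => (PC_eq z.im_pos).symm

open UpperHalfPlane in
lemma PC_ne {z : ℂ} (hz : 0 < z.im) : PC z ≠ 0 := by
  obtain ⟨c, hc⟩ := CuspForm.exists_smul_discriminant_of_weight_eq_twelve PCusp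
  have key : ∀ z : ℍ, PC z = c * ModularForm.discriminant z := fun z =>
    (DFunLike.congr_fun hc z).symm
  have hc0 : c ≠ 0 := by
    rintro rfl
    have h1 : ∀ᶠ z : ℍ in atImInfty, RQ (exp (Real.pi * Complex.I * z)) ≠ 0 :=
      (RQ_cont.tendsto.comp p_tendsto).eventually_ne RQ_zero
    obtain ⟨z, hz⟩ := h1.exists
    have h2 := key z
    rw [zero_mul, PC_eq z.im_pos] at h2
    exact mul_ne_zero (pow_ne_zero _ (exp_ne_zero _)) hz h2
  have := key ⟨z, hz⟩
  simp only at this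
  rw [this]
  exact mul_ne_zero hc0 (ModularForm.discriminant_ne_zero _)

lemma lam_diff {z : ℂ} (hz : 0 < z.im) : DifferentiableAt ℂ modularLambda z := by
  have e : modularLambda =ᶠ[𝓝 z] fun w => - Y w / Z w := by
    filter_upwards [H_nhds hz] with w hw using lam_eq hw
  exact ((Y_diff hz).neg.div (Z_diff hz) (Z_ne hz)).congr_of_eventuallyEq e

lemma lam_deriv_ne {z : ℂ} (hz : 0 < z.im) : deriv modularLambda z ≠ 0 := by
  have e : modularLambda =ᶠ[𝓝 z] fun w => (-1) * (fun w => Y w / Z w) w := by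
    filter_upwards [H_nhds hz] with w hw
    rw [lam_eq hw]; ring
  have h := ld_congr e
  rw [logDeriv_const_mul z _ (by norm_num), logDeriv_div z (Y_ne hz) (Z_ne hz) (Y_diff hz)
    (Z_diff hz), logDeriv_apply] at h
  have hP := PC_ne hz
  intro h0
  rw [h0, zero_div] at h
  apply hP
  unfold PC
  rw [← h]; ring

lemma lam_deriv_diff {z : ℂ} (hz : 0 < z.im) : DifferentiableAt ℂ (deriv modularLambda) z := by
  have hopen : IsOpen {w : ℂ | 0 < w.im} := isOpen_lt continuous_const Complex.continuous_im
  have h1 : DifferentiableOn ℂ modularLambda {w : ℂ | 0 < w.im} :=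
    fun w hw => (lam_diff hw).differentiableWithinAt
  exact (h1.deriv hopen).differentiableAt (hopen.mem_nhds hz)

lemma den_ne (γ : Matrix.SpecialLinearGroup (Fin 2) ℤ) {z : ℂ} (hz : 0 < z.im) :
    (γ.1 1 0 : ℂ) * z + (γ.1 1 1 : ℂ) ≠ 0 := by
  have := UpperHalfPlane.denom_ne_zero γ (⟨z, hz⟩ : UpperHalfPlane)
  rw [ModularGroup.denom_apply] at this
  simpa using this

lemma moeb_deriv (γ : Matrix.SpecialLinearGroup (Fin 2) ℤ) {z : ℂ} (hz : 0 < z.im) :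
    HasDerivAt (moeb γ) (((γ.1 1 0 : ℂ) * z + (γ.1 1 1 : ℂ)) ^ (-2 : ℤ)) z := by
  have hd := den_ne γ hz
  have h1 : HasDerivAt (fun z : ℂ => (γ.1 0 0 : ℂ) * z + (γ.1 0 1 : ℂ)) (γ.1 0 0 : ℂ) z := by
    simpa using ((hasDerivAt_id z).const_mul (γ.1 0 0 : ℂ)).add_const (γ.1 0 1 : ℂ)
  have h2 : HasDerivAt (fun z : ℂ => (γ.1 1 0 : ℂ) * z + (γ.1 1 1 : ℂ)) (γ.1 1 0 : ℂ) z := by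
    simpa using ((hasDerivAt_id z).const_mul (γ.1 1 0 : ℂ)).add_const (γ.1 1 1 : ℂ)
  have hdet : (γ.1 0 0 : ℂ) * (γ.1 1 1 : ℂ) - (γ.1 0 1 : ℂ) * (γ.1 1 0 : ℂ) = 1 := by
    have := γ.2
    rw [Matrix.det_fin_two] at this
    exact_mod_cast this
  have h3 := h1.fun_div h2 hd
  unfold moeb
  refine h3.congr_deriv (Eq.symm ?_)
  rw [zpow_neg, eq_div_iff (pow_ne_zero 2 hd)]
  rw [show ((2 : ℤ)) = ((2 : ℕ) : ℤ) by rfl, zpow_natCast, inv_mul_cancel₀ (pow_ne_zero 2 hd)]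
  linear_combination -hdet

lemma lam_deriv_inv {γ : Matrix.SpecialLinearGroup (Fin 2) ℤ}
    (hγ : γ ∈ CongruenceSubgroup.Gamma 2) {z : ℂ} (hz : 0 < z.im) :
    deriv modularLambda (moeb γ z) * ((γ.1 1 0 : ℂ) * z + (γ.1 1 1 : ℂ)) ^ (-2 : ℤ) =
      deriv modularLambda z := by
  have e : modularLambda ∘ moeb γ =ᶠ[𝓝 z] modularLambda := by
    filter_upwards [H_nhds hz] with w hw using lam_inv hγ hw
  rw [← e.deriv_eq]
  exact ((lam_diff (moeb_im γ hz)).hasDerivAt.comp z (moeb_deriv γ hz)).deriv.symm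

end LamAux

/-- If `f` is holomorphic on `ℍ` and satisfies `f|₂(γ-1) = d_γ η⁴` for all `γ ∈ Γ(2)`,
then `((λ f / λ')')|₂(γ-1) = (d_γ λ η⁴ / λ')'` for every `γ ∈ Γ(2)`. -/
theorem second_order_deriv_transform (f : ℂ → ℂ)
    (hf : ∀ z : ℂ, 0 < z.im → DifferentiableAt ℂ f z)
    (d : Matrix.SpecialLinearGroup (Fin 2) ℤ → ℂ)
    (htrans : ∀ γ ∈ CongruenceSubgroup.Gamma 2, ∀ z : ℂ, 0 < z.im →
      f (moeb γ z) * ((γ.1 1 0 : ℂ) * z + (γ.1 1 1 : ℂ)) ^ (-2 : ℤ) - f z =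
        d γ * dedekindEta z ^ 4) :
    ∀ γ ∈ CongruenceSubgroup.Gamma 2, ∀ z : ℂ, 0 < z.im →
      deriv (fun w : ℂ => modularLambda w * f w / deriv modularLambda w) (moeb γ z) *
            ((γ.1 1 0 : ℂ) * z + (γ.1 1 1 : ℂ)) ^ (-2 : ℤ) -
          deriv (fun w : ℂ => modularLambda w * f w / deriv modularLambda w) z =
        deriv (fun w : ℂ =>
          d γ * modularLambda w * dedekindEta w ^ 4 / deriv modularLambda w) z := by
  intro γ hγ z hz
  have gd : ∀ w : ℂ, 0 < w.im →
      DifferentiableAt ℂ (fun w : ℂ => modularLambda w * f w / deriv modularLambda w) w :=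
    fun w hw => ((LamAux.lam_diff hw).mul (hf w hw)).div (LamAux.lam_deriv_diff hw)
      (LamAux.lam_deriv_ne hw)
  have hd : DifferentiableAt ℂ (fun w : ℂ =>
      d γ * modularLambda w * dedekindEta w ^ 4 / deriv modularLambda w) z :=
    (((LamAux.lam_diff hz).const_mul (d γ)).mul ((LamAux.eta_diff hz).pow 4)).div
      (LamAux.lam_deriv_diff hz) (LamAux.lam_deriv_ne hz)
  have e : (fun w : ℂ => modularLambda w * f w / deriv modularLambda w) ∘ moeb γ =ᶠ[nhds z]
      fun w => (fun w : ℂ => modularLambda w * f w / deriv modularLambda w) w +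
        (fun w : ℂ => d γ * modularLambda w * dedekindEta w ^ 4 / deriv modularLambda w) w := by
    filter_upwards [LamAux.H_nhds hz] with w hw
    have h1 := LamAux.lam_inv hγ hw
    have h2 := LamAux.lam_deriv_inv hγ hw
    have h3 := htrans γ hγ w hw
    have h4 := LamAux.lam_deriv_ne hw
    have h5 := LamAux.lam_deriv_ne (LamAux.moeb_im γ hw)
    simp only [Function.comp]
    rw [h1]
    rw [← add_div, div_eq_div_iff h5 h4, ← h2]
    linear_combination modularLambda w * deriv modularLambda (moeb γ w) * h3
  have hl := ((gd _ (LamAux.moeb_im γ hz)).hasDerivAt.comp z (LamAux.moeb_deriv γ hz)).deriv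
  have hr := ((gd z hz).hasDerivAt.add hd.hasDerivAt).deriv
  rw [← hl, e.deriv_eq, sub_eq_iff_eq_add']
  exact hr
end
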